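/- Let A be a unital simple separable C*-algebra which is approximately divisible, has real rank zero, is stably finite, and has strict comparison of positive elements. Then for every positive element a of A, the set S_a = { b ∈ A : b is positive and b is Cuntz equivalent to a } is path connected in the norm topology. -/

import Mathlib

open Filter Topology

section Defs

variable {A : Type*}

/-- Cuntz subequivalence: `a ≾ b` iff there is a sequence `vₙ` with `‖vₙ * b * vₙ* - a‖ → 0`. -/
def CuntzLE [NonUnitalCStarAlgebra A] (a b : A) : Prop :=
  ∃ v : ℕ → A, Tendsto (fun n => ‖v n * b * star (v n) - a‖) atTop (𝓝 0)

/-- Cuntz equivalence: `a ∼ b` iff `a ≾ b` and `b ≾ a`. -/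
def CuntzEquiv [NonUnitalCStarAlgebra A] (a b : A) : Prop :=
  CuntzLE a b ∧ CuntzLE b a

/-- A projection: a self-adjoint idempotent. -/
def IsProjection [Mul A] [Star A] (p : A) : Prop :=
  IsSelfAdjoint p ∧ p * p = p

/-- Murray–von Neumann equivalence of projections. -/
def MvNEquiv [Mul A] [Star A] (p q : A) : Prop :=
  ∃ v : A, star v * v = p ∧ v * star v = q

/-- The hereditary subalgebra generated by a positive element `a`: the closure of `a A a`. -/
def her [NonUnitalCStarAlgebra A] (a : A) : Set A :=
  closure {x : A | ∃ y : A, x = a * y * a}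

/-- A C*-algebra is simple if its only closed two-sided ideals are `⊥` and `⊤`. -/
def IsSimpleCStarAlgebra (A : Type*) [NonUnitalCStarAlgebra A] : Prop :=
  ∀ I : TwoSidedIdeal A, IsClosed (I : Set A) → I = ⊥ ∨ I = ⊤

/-- A unital C*-algebra is approximately divisible if for each `N ≥ 1` there is an
approximately central sequence of unital `*`-homomorphisms `M_N(ℂ) ⊕ M_{N+1}(ℂ) → A`. -/
def ApproximatelyDivisible (A : Type*) [CStarAlgebra A] : Prop :=
  ∀ N : ℕ, 0 < N →
    ∃ φ : ℕ → (Matrix (Fin N) (Fin N) ℂ × Matrix (Fin (N + 1)) (Fin (N + 1)) ℂ) →⋆ₐ[ℂ] A,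
      ∀ x c, Tendsto (fun n => ‖(φ n) x * c - c * (φ n) x‖) atTop (𝓝 (0 : ℝ))

/-- Real rank zero: every self-adjoint element is a norm limit of self-adjoint elements
with finite spectrum. -/
def RealRankZero (A : Type*) [CStarAlgebra A] : Prop :=
  ∀ a : A, IsSelfAdjoint a → ∀ ε : ℝ, 0 < ε →
    ∃ b : A, IsSelfAdjoint b ∧ (spectrum ℂ b).Finite ∧ ‖a - b‖ < ε

/-- Stable finiteness: every isometry in every matrix algebra over `A` is a unitary. -/
def StablyFinite (A : Type*) [CStarAlgebra A] : Prop :=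
  ∀ n : ℕ, ∀ v : Matrix (Fin n) (Fin n) A, star v * v = 1 → v * star v = 1

/-- A tracial state: a unital positive linear functional satisfying the trace identity. -/
def IsTracialState [CStarAlgebra A] (φ : A →ₗ[ℂ] ℂ) : Prop :=
  φ 1 = 1 ∧ (∀ x : A, ∃ r : ℝ, 0 ≤ r ∧ φ (star x * x) = (r : ℂ)) ∧
    ∀ x y : A, φ (x * y) = φ (y * x)

/-- The dimension function associated to a tracial state:
`d_τ(a) = lim_{n → ∞} τ(a^{1/n})`. -/
noncomputable def dTau [CStarAlgebra A] (φ : A →ₗ[ℂ] ℂ) (a : A) : ℝ :=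
  limUnder atTop (fun n : ℕ => (φ (cfc (fun t : ℝ => t ^ ((n : ℝ)⁻¹)) a)).re)

/-- Strict comparison of positive elements with respect to tracial states. -/
def StrictComparison (A : Type*) [CStarAlgebra A] [PartialOrder A] [StarOrderedRing A] : Prop :=
  ∀ a b : A, 0 ≤ a → 0 ≤ b →
    (∀ φ : A →ₗ[ℂ] ℂ, IsTracialState φ → dTau φ a < dTau φ b) → CuntzLE a b

end Defs



section Basics

set_option linter.unusedSectionVars false

variable {A : Type*} [CStarAlgebra A] [PartialOrder A] [StarOrderedRing A]

lemma mul_mid {a b c : A} (h : a * b = c) (x : A) : a * (b * x) = c * x := by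
  rw [← mul_assoc, h]

lemma eq_zero_of_star_conj {e z : A} (he : 0 ≤ e) (h : star z * e * z = 0) : e * z = 0 := by
  have hs := CFC.sqrt_mul_sqrt_self e he
  have hsa : star (CFC.sqrt e) = CFC.sqrt e := (CFC.sqrt_nonneg e).star_eq
  have : star (CFC.sqrt e * z) * (CFC.sqrt e * z) = 0 := by
    rw [star_mul, hsa]
    calc _ = star z * (CFC.sqrt e * CFC.sqrt e) * z := by simp only [mul_assoc]
      _ = 0 := by rw [hs, h]
  have h2 : CFC.sqrt e * z = 0 := CStarRing.star_mul_self_eq_zero_iff _ |>.1 this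
  rw [← hs, mul_assoc, h2, mul_zero]

lemma dom_kill {e x z : A} {K : ℝ} (he : 0 ≤ e) (h : e ≤ K • x) (hz : x * z = 0) : e * z = 0 := by
  apply eq_zero_of_star_conj he
  apply le_antisymm
  · have := star_left_conjugate_le_conjugate h z
    simpa [mul_assoc, hz] using this
  · exact star_left_conjugate_nonneg he z

lemma dom_kill' {e x z : A} {K : ℝ} (he : 0 ≤ e) (h : e ≤ K • x) (hz : x * star z = 0) :
    z * e = 0 := by
  have := dom_kill he h hz
  have h2 := congrArg star this
  simpa [he.star_eq] using h2

lemma le_norm_smul_one {x : A} (hx : IsSelfAdjoint x) : x ≤ ‖x‖ • (1 : A) := by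
  have := hx.le_algebraMap_norm_self
  rwa [Algebra.algebraMap_eq_smul_one] at this

lemma norm_le_of_le_smul_one {x : A} {r : ℝ} (hr : 0 ≤ r) (hx : 0 ≤ x) (h : x ≤ r • (1 : A)) :
    ‖x‖ ≤ r := by
  rw [CStarAlgebra.norm_le_iff_le_algebraMap x hr hx, Algebra.algebraMap_eq_smul_one]
  exact h

lemma le_smul_one_of_norm_le {x : A} {r : ℝ} (hx : IsSelfAdjoint x) (h : ‖x‖ ≤ r) :
    x ≤ r • (1 : A) :=
  (le_norm_smul_one hx).trans (smul_le_smul_of_nonneg_right h zero_le_one)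

/-- conjugates of small things: `‖z* z‖ = ‖z z*‖` in order form -/
lemma flip_le {z : A} {r : ℝ} (hr : 0 ≤ r) (h : star z * z ≤ r • (1 : A)) :
    z * star z ≤ r • (1 : A) := by
  apply le_smul_one_of_norm_le (IsSelfAdjoint.mul_star_self z)
  rw [CStarRing.norm_self_mul_star, ← CStarRing.norm_star_mul_self]
  exact norm_le_of_le_smul_one hr (star_mul_self_nonneg z) h

lemma proj_polar {w p : A} (hp : IsStarProjection p) (h : w * star w = p) :
    p * w = w ∧ IsStarProjection (star w * w) := by
  have hpp : p * p = p := hp.isIdempotentElem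
  have hps : star p = p := hp.isSelfAdjoint
  have h1 : (p * w - w) * star (p * w - w) = 0 := by
    have : star (p * w - w) = star w * p - star w := by simp [hps]
    rw [this]
    calc _ = p * (w * star w) * p - p * (w * star w) - (w * star w) * p + w * star w := by
            noncomm_ring
      _ = 0 := by rw [h]; simp [hpp]
  have h2 : p * w = w := sub_eq_zero.1 (CStarRing.mul_star_self_eq_zero_iff _ |>.1 h1)
  refine ⟨h2, ⟨?_, IsSelfAdjoint.star_mul_self w⟩⟩
  show star w * w * (star w * w) = star w * w
  calc _ = star w * ((w * star w) * w) := by simp only [mul_assoc]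
    _ = _ := by rw [h, h2]

/-- Polar decomposition of `p m` when `p m m* p` is invertible in the corner. -/
theorem polar {p m : A} (hp : IsStarProjection p) {δ : ℝ} (hδ : 0 < δ)
    (h : δ • p ≤ p * m * star m * p) :
    ∃ w k k' : A, w * star w = p ∧ w = k * (p * m) ∧ p * m = k' * w ∧ star k' = k' ∧
      Commute k' p ∧ Commute k p := by
  have hpp : p * p = p := hp.isIdempotentElem
  have hps : star p = p := hp.isSelfAdjoint
  set g : A := p * m * star m * p + (1 - p) with hg
  have h1p : 0 ≤ 1 - p := hp.one_sub_nonneg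
  have hq : (1 - p) * (1 - p) = 1 - p := hp.one_sub.isIdempotentElem
  have hle : (min δ 1) • (1 : A) ≤ g := by
    calc (min δ 1) • (1 : A) = (min δ 1) • p + (min δ 1) • (1 - p) := by
            rw [← smul_add]; simp
      _ ≤ δ • p + (1 : ℝ) • (1 - p) := by
            exact add_le_add (smul_le_smul_of_nonneg_right (min_le_left _ _) hp.nonneg)
              (smul_le_smul_of_nonneg_right (min_le_right _ _) h1p)
      _ ≤ g := by rw [one_smul]; exact add_le_add h le_rfl
  have hmin : 0 < min δ 1 := lt_min hδ one_pos
  have hg0 : 0 ≤ g := le_trans (smul_nonneg hmin.le zero_le_one) hle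
  have hu : IsUnit g := by
    refine CStarAlgebra.isUnit_of_le _ hle ⟨smul_nonneg hmin.le zero_le_one, ?_⟩
    rw [← Algebra.algebraMap_eq_smul_one]
    exact (IsUnit.mk0 _ hmin.ne').map _
  have hus : IsUnit (CFC.sqrt g) := (CFC.isUnit_sqrt_iff g hg0).2 hu
  obtain ⟨u, hu'⟩ := hus
  have hss := CFC.sqrt_mul_sqrt_self g hg0
  have hsa : star (CFC.sqrt g) = CFC.sqrt g := (CFC.sqrt_nonneg g).star_eq
  have hgp : g * p = p * m * star m * p := by
    rw [hg, add_mul, sub_mul]; simp [mul_assoc, hpp]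
  have hpg : p * g = p * m * star m * p := by
    rw [hg, mul_add, mul_sub]; simp [← mul_assoc, hpp]
  have hcg : Commute g p := by rw [Commute, SemiconjBy, hgp, hpg]
  have hc' : Commute (CFC.sqrt g) p := hcg.cfcₙ_nnreal _
  rw [← hu'] at hss hsa hc'
  have hc : Commute (↑u⁻¹ : A) p := hc'.units_inv_left
  have hsai : star (↑u⁻¹ : A) = ↑u⁻¹ := by
    have h1 : star (↑u⁻¹ : A) * (u : A) = 1 := by
      rw [← hsa, ← star_mul]; simp
    calc star (↑u⁻¹ : A) = star (↑u⁻¹ : A) * (u * ↑u⁻¹) := by simp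
      _ = ↑u⁻¹ := by rw [← mul_assoc, h1, one_mul]
  refine ⟨↑u⁻¹ * (p * m), ↑u⁻¹, u, ?_, rfl, by simp, hsa, hc', hc⟩
  have e1 : ↑u⁻¹ * (p * m) * star (↑u⁻¹ * (p * m)) = ↑u⁻¹ * (g * p) * ↑u⁻¹ := by
    rw [hgp]; simp only [star_mul, hsai, hps, mul_assoc]
  rw [e1, ← hss]
  calc ↑u⁻¹ * ((u : A) * u * p) * ↑u⁻¹ = u * p * ↑u⁻¹ := by simp [← mul_assoc]
    _ = p := by rw [hc'.eq, mul_assoc]; simp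

end Basics


section Key

set_option linter.unusedSectionVars false

variable {A : Type*} [CStarAlgebra A] [PartialOrder A] [StarOrderedRing A]

/-- `x` is dominated by a positive multiple of `y`. -/
def Dom (x y : A) : Prop := ∃ K : ℝ, 0 < K ∧ x ≤ K • y

lemma Dom.refl (x : A) : Dom x x := ⟨1, one_pos, by simp⟩

lemma Dom.trans {x y z : A} (h : Dom x y) (h' : Dom y z) : Dom x z := by
  obtain ⟨K, hK, h⟩ := h
  obtain ⟨L, hL, h'⟩ := h'
  refine ⟨K * L, by positivity, h.trans ?_⟩
  rw [mul_smul]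
  exact smul_le_smul_of_nonneg_left h' hK.le

lemma Dom.of_le {x y : A} (h : x ≤ y) : Dom x y := ⟨1, one_pos, by simpa using h⟩

lemma Dom.add {x y z : A} (h : Dom x z) (h' : Dom y z) : Dom (x + y) z := by
  obtain ⟨K, hK, h⟩ := h
  obtain ⟨L, hL, h'⟩ := h'
  exact ⟨K + L, by positivity, by rw [add_smul]; exact add_le_add h h'⟩

lemma Dom.smul {x y : A} (hy : 0 ≤ y) (h : Dom x y) {c : ℝ} (hc : 0 ≤ c) : Dom (c • x) y := by
  obtain ⟨K, hK, h⟩ := h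
  refine ⟨c * K + 1, by positivity, ?_⟩
  calc c • x ≤ c • K • y := smul_le_smul_of_nonneg_left h hc
    _ = (c * K) • y := by rw [mul_smul]
    _ ≤ (c * K + 1) • y := smul_le_smul_of_nonneg_right (by linarith) hy

lemma Dom.kill {e x z : A} (he : 0 ≤ e) (h : Dom e x) (hz : x * z = 0) : e * z = 0 := by
  obtain ⟨K, hK, h⟩ := h
  exact dom_kill he h hz

lemma Dom.kill' {e x z : A} (he : 0 ≤ e) (h : Dom e x) (hz : x * star z = 0) : z * e = 0 := by
  obtain ⟨K, hK, h⟩ := h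
  exact dom_kill' he h hz

/-- projection dominated by projection -/
lemma Dom.proj {e p : A} (he : IsStarProjection e) (hp : IsStarProjection p) (h : Dom e p) :
    e * p = e ∧ p * e = e ∧ e ≤ p := by
  have h1 : e * (1 - p) = 0 := h.kill he.nonneg hp.mul_one_sub_self
  have h2 : (1 - p) * e = 0 := h.kill' he.nonneg (by
    rw [hp.one_sub.isSelfAdjoint.star_eq, hp.mul_one_sub_self])
  have h1' : e * p = e := by rw [mul_sub, mul_one, sub_eq_zero] at h1; exact h1.symm
  have h2' : p * e = e := by rw [sub_mul, one_mul, sub_eq_zero] at h2; exact h2.symm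
  exact ⟨h1', h2', (he.le_iff_mul_eq_left hp).2 h1'⟩

lemma dom_of_eq_mul {w k m : A} (h : w = k * m) : Dom (star w * w) (star m * m) := by
  refine ⟨‖star k * k‖ + 1, by positivity, ?_⟩
  have h1 : star w * w = star m * (star k * k) * m := by rw [h]; simp [mul_assoc]
  rw [h1]
  refine (CStarAlgebra.star_left_conjugate_le_norm_smul (IsSelfAdjoint.star_mul_self k)).trans ?_
  exact smul_le_smul_of_nonneg_right (by linarith) (star_mul_self_nonneg m)

/-- `p` is equivalent to a projection dominated by `star m * m`, if `p m m* p` is bounded below. -/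
lemma sub_of_lower {p m : A} (hp : IsStarProjection p) {δ : ℝ} (hδ : 0 < δ)
    (h : δ • p ≤ p * m * star m * p) :
    ∃ w : A, w * star w = p ∧ IsStarProjection (star w * w) ∧ Dom (star w * w) (star m * m) := by
  obtain ⟨w, k, k', h1, h2, -⟩ := polar hp hδ h
  refine ⟨w, h1, (proj_polar hp h1).2, ?_⟩
  exact dom_of_eq_mul (k := k * p) (by rw [h2, mul_assoc])

lemma compression_le {a : A} (ha : 0 ≤ a) {f : A} (hf : IsStarProjection f) :
    star (f * CFC.sqrt a) * (f * CFC.sqrt a) ≤ a := by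
  have hs := CFC.sqrt_mul_sqrt_self a ha
  have hsa : star (CFC.sqrt a) = CFC.sqrt a := (CFC.sqrt_nonneg a).star_eq
  have h1 := star_left_conjugate_le_conjugate hf.le_one (CFC.sqrt a)
  have hff : f * f = f := hf.isIdempotentElem
  rw [mul_one, hsa, hs] at h1
  rw [star_mul, hsa, hf.isSelfAdjoint.star_eq, mul_assoc, ← mul_assoc f, hff, ← mul_assoc]
  exact h1

/-- The key consequence of real rank zero. -/
theorem key (hrr0 : RealRankZero A) {x : A} (hx : 0 ≤ x) {ε : ℝ} (hε : 0 < ε) :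
    ∃ e : A, IsStarProjection e ∧ Dom e x ∧ (1 - e) * x * (1 - e) ≤ ε • (1 : A) := by
  obtain ⟨b, hb, hfin, hxb⟩ := hrr0 x hx.isSelfAdjoint (ε / 4) (by positivity)
  set η := ε / 4 with hη
  have hη0 : 0 < η := by positivity
  have hfinR : (spectrum ℝ b).Finite := by
    have : (spectrum ℝ b) = (fun r : ℝ => (r : ℂ)) ⁻¹' (spectrum ℂ b) := by
      rw [← spectrum.preimage_algebraMap (S := ℂ)]; rfl
    rw [this]
    exact hfin.preimage (Complex.ofReal_injective.injOn)
  have hcont : ∀ f : ℝ → ℝ, ContinuousOn f (spectrum ℝ b) := fun f => hfinR.continuousOn f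
  set χ : ℝ → ℝ := fun t => if 2 * η ≤ t then 1 else 0 with hχ
  set f : A := cfc χ b with hf
  have hfp : IsStarProjection f := by
    refine ⟨?_, cfc_predicate _ _⟩
    show f * f = f
    rw [hf, ← cfc_mul χ χ b (hcont _) (hcont _)]
    congr 1
    ext t
    simp [hχ]
  have hff : f * f = f := hfp.isIdempotentElem
  have hfs : star f = f := hfp.isSelfAdjoint
  have hbid : cfc (fun t : ℝ => t) b = b := cfc_id' ℝ b
  have hfb : f * b * f = cfc (fun t => χ t * t * χ t) b := by
    rw [cfc_mul _ _ b (hcont _) (hcont _), cfc_mul _ _ b (hcont _) (hcont _), hbid]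
  have hlow : (2 * η) • f ≤ f * b * f := by
    rw [hfb, hf, ← cfc_smul (2 * η) χ b (hcont _)]
    apply cfc_mono _ (hcont _) (hcont _)
    intro t _
    simp only [hχ, smul_eq_mul]
    split_ifs with h <;> simp [h]
  have h1f : (1 - f) = cfc (fun t => 1 - χ t) b := by
    rw [cfc_sub _ _ b (hcont _) (hcont _), cfc_const_one ℝ b]
  have hup : (1 - f) * b * (1 - f) ≤ (2 * η) • (1 - f) := by
    have : (1 - f) * b * (1 - f) = cfc (fun t => (1 - χ t) * t * (1 - χ t)) b := by
      rw [cfc_mul _ _ b (hcont _) (hcont _), cfc_mul _ _ b (hcont _) (hcont _), hbid, h1f]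
    rw [this, h1f, ← cfc_smul (2 * η) _ b (hcont _)]
    apply cfc_mono _ (hcont _) (hcont _)
    intro t _
    simp only [hχ, smul_eq_mul]
    split_ifs with h
    · simp
    · simp; exact (not_le.1 h).le
  have hsa1 : IsSelfAdjoint (x - b) := hx.isSelfAdjoint.sub hb
  have hd1 : x - b ≤ η • (1 : A) := le_smul_one_of_norm_le hsa1 hxb.le
  have hd2 : b - x ≤ η • (1 : A) := le_smul_one_of_norm_le (hb.sub hx.isSelfAdjoint)
    (by rw [norm_sub_rev]; exact hxb.le)
  have hs := CFC.sqrt_mul_sqrt_self x hx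
  have hsa : star (CFC.sqrt x) = CFC.sqrt x := (CFC.sqrt_nonneg x).star_eq
  have hlowx : η • f ≤ f * CFC.sqrt x * star (CFC.sqrt x) * f := by
    rw [hsa, mul_assoc f, hs]
    have h2 := star_left_conjugate_le_conjugate hd2 f
    rw [hfs] at h2
    have e1 : f * (b - x) * f = f * b * f - f * x * f := by noncomm_ring
    have e2 : f * (η • (1 : A)) * f = η • f := by simp [hff]
    rw [e1, e2] at h2
    have h3 : (2 * η) • f = η • f + η • f := by rw [two_mul, add_smul]
    rw [h3] at hlow
    have h4 := add_le_add hlow h2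
    have h5 : η • f + (η • f + f * b * f) ≤ f * x * f + (η • f + f * b * f) := by
      calc η • f + (η • f + f * b * f) = η • f + η • f + (f * b * f - f * x * f) + f * x * f := by
            abel
        _ ≤ f * b * f + η • f + f * x * f := by gcongr
        _ = _ := by abel
    exact le_of_add_le_add_right h5
  obtain ⟨w, k, k', h1, h2, h3, h4, h5, h6⟩ := polar hfp hη0 hlowx
  have hw := proj_polar hfp h1
  refine ⟨star w * w, hw.2, (dom_of_eq_mul h2).trans (Dom.of_le (compression_le hx hfp)), ?_⟩
  set e := star w * w with he
  -- `(1-e) √x f = 0`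
  have hz : (f * CFC.sqrt x) * (1 - e) = 0 := by
    rw [h3, mul_sub, mul_one, sub_eq_zero, he]
    rw [mul_assoc, ← mul_assoc w, h1, hw.1]
  have hz' : CFC.sqrt x * (1 - e) = (1 - f) * CFC.sqrt x * (1 - e) := by
    have : CFC.sqrt x * (1 - e) = (1 - f) * CFC.sqrt x * (1 - e) + f * CFC.sqrt x * (1 - e) := by
      noncomm_ring
    rw [this, hz, add_zero]
  have h1es : star (1 - e) = 1 - e := hw.2.one_sub.isSelfAdjoint
  have h1ff : (1 - f) * (1 - f) = 1 - f := hfp.one_sub.isIdempotentElem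
  have h1fs : star (1 - f) = 1 - f := hfp.one_sub.isSelfAdjoint
  have hexp : (1 - e) * x * (1 - e) =
      star (1 - e) * (star ((1 - f) * CFC.sqrt x) * ((1 - f) * CFC.sqrt x)) * (1 - e) := by
    calc (1 - e) * x * (1 - e) = star (CFC.sqrt x * (1 - e)) * (CFC.sqrt x * (1 - e)) := by
          rw [star_mul, hsa, h1es]
          conv_lhs => rw [← hs]
          simp only [mul_assoc]
      _ = _ := by rw [hz']; simp only [star_mul, mul_assoc]
  have hin : star ((1 - f) * CFC.sqrt x) * ((1 - f) * CFC.sqrt x) ≤ ε • (1 : A) := by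
    have h7 : star (star ((1 - f) * CFC.sqrt x)) * star ((1 - f) * CFC.sqrt x)
        ≤ ε • (1 : A) := by
      rw [star_star, star_mul, hsa, h1fs]
      have e0 : (1 - f) * CFC.sqrt x * (CFC.sqrt x * (1 - f)) = (1 - f) * x * (1 - f) := by
        conv_rhs => rw [← hs]
        simp only [mul_assoc]
      rw [e0]
      have h8 := star_left_conjugate_le_conjugate hd1 (1 - f)
      rw [h1fs] at h8
      have e1 : (1 - f) * (x - b) * (1 - f) = (1 - f) * x * (1 - f) - (1 - f) * b * (1 - f) := by
        noncomm_ring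
      have e2 : (1 - f) * (η • (1 : A)) * (1 - f) = η • (1 - f) := by
        rw [mul_smul_comm, mul_one, smul_mul_assoc, h1ff]
      rw [e1, e2, sub_le_iff_le_add] at h8
      calc _ ≤ η • (1 - f) + (2 * η) • (1 - f) := h8.trans (add_le_add le_rfl hup)
        _ = (3 * η) • (1 - f) := by rw [← add_smul]; congr 1; ring
        _ ≤ (3 * η) • (1 : A) := smul_le_smul_of_nonneg_left (by simpa using hfp.nonneg) (by positivity)
        _ ≤ ε • (1 : A) := smul_le_smul_of_nonneg_right (by linarith) zero_le_one
    have := flip_le hε.le h7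
    rwa [star_star] at this
  rw [hexp]
  refine (star_left_conjugate_le_conjugate hin (1 - e)).trans ?_
  rw [h1es, mul_smul_comm, mul_one, smul_mul_assoc,
    (hw.2.one_sub.isIdempotentElem : (1 - e) * (1 - e) = 1 - e)]
  exact smul_le_smul_of_nonneg_left (by simpa using hw.2.nonneg) hε.le

/-- transport of projections along Cuntz subequivalence -/
theorem sub_of_cuntz {p a b : A} (hp : IsStarProjection p) (hb : 0 ≤ b) (hpa : Dom p a)
    (hab : CuntzLE a b) :
    ∃ w : A, w * star w = p ∧ IsStarProjection (star w * w) ∧ Dom (star w * w) b := by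
  obtain ⟨K, hK, hpa⟩ := hpa
  obtain ⟨v, hv⟩ := hab
  have hev := (hv.eventually (gt_mem_nhds (show (0 : ℝ) < K⁻¹ / 2 by positivity))).exists
  obtain ⟨n, hn⟩ := hev
  have hpp : p * p = p := hp.isIdempotentElem
  have hps : star p = p := hp.isSelfAdjoint
  have hs := CFC.sqrt_mul_sqrt_self b hb
  have hsa : star (CFC.sqrt b) = CFC.sqrt b := (CFC.sqrt_nonneg b).star_eq
  set y := v n * b * star (v n) with hy
  have hy0 : 0 ≤ y := star_right_conjugate_nonneg hb _
  have hpay : K⁻¹ • p ≤ a := by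
    have := smul_le_smul_of_nonneg_left hpa (inv_nonneg.2 hK.le)
    rwa [smul_smul, inv_mul_cancel₀ hK.ne', one_smul] at this
  have hasa : IsSelfAdjoint a :=
    IsSelfAdjoint.of_ge hpay (IsSelfAdjoint.smul (by simp [IsSelfAdjoint]) hp.isSelfAdjoint)
  have hd : a - y ≤ (K⁻¹ / 2) • (1 : A) := le_smul_one_of_norm_le (hasa.sub hy0.isSelfAdjoint)
    (by rw [norm_sub_rev]; exact hn.le)
  have hlow : (K⁻¹ / 2) • p ≤ p * (v n * CFC.sqrt b) * star (v n * CFC.sqrt b) * p := by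
    have e0 : p * (v n * CFC.sqrt b) * star (v n * CFC.sqrt b) * p = p * y * p := by
      rw [hy]
      conv_rhs => rw [← hs]
      simp only [star_mul, hsa, mul_assoc]
    rw [e0]
    have h1 : K⁻¹ • p - (K⁻¹ / 2) • (1 : A) ≤ y := by
      rw [sub_le_comm] at hd
      exact (sub_le_sub_right hpay _).trans hd
    have h2 := star_left_conjugate_le_conjugate h1 p
    rw [hps] at h2
    have e1 : p * (K⁻¹ • p - (K⁻¹ / 2) • (1 : A)) * p = (K⁻¹ / 2) • p := by
      rw [mul_sub, sub_mul, mul_smul_comm, mul_smul_comm, hpp, mul_one, smul_mul_assoc,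
        smul_mul_assoc, hpp, ← sub_smul]
      congr 1; ring
    rwa [e1] at h2
  obtain ⟨w, h1, h2, h3⟩ := sub_of_lower hp (by positivity) hlow
  refine ⟨w, h1, h2, h3.trans ?_⟩
  refine (dom_of_eq_mul (k := v n) (m := CFC.sqrt b) rfl).trans ?_
  rw [hsa, hs]
  exact Dom.refl b

end Key


section CuntzBasics

set_option linter.unusedSectionVars false
variable {A : Type*} [CStarAlgebra A] [PartialOrder A] [StarOrderedRing A]

lemma cuntzLE_iff {a b : A} :
    CuntzLE a b ↔ ∀ ε : ℝ, 0 < ε → ∃ v : A, ‖v * b * star v - a‖ < ε := by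
  constructor
  · rintro ⟨v, hv⟩ ε hε
    obtain ⟨n, hn⟩ := (hv.eventually (gt_mem_nhds hε)).exists
    exact ⟨v n, hn⟩
  · intro h
    choose v hv using fun n : ℕ => h (1 / ((n : ℝ) + 1)) (by positivity)
    exact ⟨v, squeeze_zero (fun n => norm_nonneg _) (fun n => (hv n).le)
      tendsto_one_div_add_atTop_nhds_zero_nat⟩

lemma CuntzLE.trans' {a b c : A} (h : CuntzLE a b) (h' : CuntzLE b c) : CuntzLE a c := by
  rw [cuntzLE_iff] at *
  intro ε hε
  obtain ⟨v, hv⟩ := h (ε / 2) (by positivity)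
  obtain ⟨w, hw⟩ := h' (ε / 2 / (‖v‖ * ‖v‖ + 1)) (by positivity)
  refine ⟨v * w, ?_⟩
  have e : v * w * c * star (v * w) - a
      = v * (w * c * star w - b) * star v + (v * b * star v - a) := by
    rw [star_mul]; noncomm_ring
  rw [e]
  refine (norm_add_le _ _).trans_lt ?_
  have h1 : ‖v * (w * c * star w - b) * star v‖ ≤ ε / 2 := by
    calc _ ≤ ‖v‖ * ‖w * c * star w - b‖ * ‖star v‖ := norm_mul₃_le
      _ = (‖v‖ * ‖v‖) * ‖w * c * star w - b‖ := by rw [norm_star]; ring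
      _ ≤ (‖v‖ * ‖v‖ + 1) * (ε / 2 / (‖v‖ * ‖v‖ + 1)) := by gcongr; linarith
      _ = ε / 2 := by field_simp
  linarith

lemma CuntzLE.of_approx {a b : A} (h : ∀ ε : ℝ, 0 < ε → ∃ c, CuntzLE c b ∧ ‖c - a‖ < ε) :
    CuntzLE a b := by
  rw [cuntzLE_iff]
  intro ε hε
  obtain ⟨c, hc, hca⟩ := h (ε / 2) (by positivity)
  obtain ⟨v, hv⟩ := cuntzLE_iff.1 hc (ε / 2) (by positivity)
  refine ⟨v, ?_⟩
  have e : v * b * star v - a = (v * b * star v - c) + (c - a) := by abel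
  rw [e]
  exact (norm_add_le _ _).trans_lt (by linarith)

lemma CuntzLE.of_eq_conj {a b v : A} (h : v * b * star v = a) : CuntzLE a b := by
  rw [cuntzLE_iff]
  intro ε hε
  exact ⟨v, by rw [h, sub_self, norm_zero]; exact hε⟩

lemma CuntzLE.refl' (a : A) : CuntzLE a a := CuntzLE.of_eq_conj (v := 1) (by simp)

lemma CuntzLE.smul_right {x : A} {K : ℝ} (hK : 0 ≤ K) : CuntzLE (K • x) x := by
  apply CuntzLE.of_eq_conj (v := Real.sqrt K • (1 : A))
  have : star (Real.sqrt K • (1 : A)) = Real.sqrt K • (1 : A) := by simp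
  rw [this]
  simp [smul_smul, Real.mul_self_sqrt hK]

lemma CuntzLE.of_le {x y : A} (hx : 0 ≤ x) (hxy : x ≤ y) : CuntzLE x y := by
  rw [cuntzLE_iff]
  intro ε hε
  have hy : 0 ≤ y := hx.trans hxy
  set δ := ε / 4 with hδ
  have hδ0 : 0 < δ := by positivity
  have hspec : ∀ t ∈ spectrum ℝ y, 0 ≤ t := fun t ht => spectrum_nonneg_of_nonneg hy ht
  have hs := CFC.sqrt_mul_sqrt_self x hx
  have hsa : star (CFC.sqrt x) = CFC.sqrt x := (CFC.sqrt_nonneg x).star_eq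
  set g : ℝ → ℝ := fun t => Real.sqrt t / (t + δ) with hg
  set d : ℝ → ℝ := fun t => Real.sqrt (δ * (2 * t + δ)) / (t + δ) with hd
  have hgc : ContinuousOn g (spectrum ℝ y) := by
    apply ContinuousOn.div (by fun_prop) (by fun_prop)
    intro t ht; have := hspec t ht; positivity
  have hdc : ContinuousOn d (spectrum ℝ y) := by
    apply ContinuousOn.div (by fun_prop) (by fun_prop)
    intro t ht; have := hspec t ht; positivity
  have hid : cfc (fun t : ℝ => t) y = y := cfc_id' ℝ y
  have hgs : star (cfc g y) = cfc g y := (cfc_predicate g y : IsSelfAdjoint _)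
  have hds : star (cfc d y) = cfc d y := (cfc_predicate d y : IsSelfAdjoint _)
  have hsum : cfc g y * y * cfc g y + cfc d y * cfc d y = 1 := by
    have e1 : cfc g y * y * cfc g y = cfc (fun t => g t * t * g t) y := by
      rw [cfc_mul (fun t => g t * t) g y (hgc.mul continuousOn_id) hgc,
        cfc_mul g (fun t => t) y hgc continuousOn_id, hid]
    have e2 : cfc d y * cfc d y = cfc (fun t => d t * d t) y := (cfc_mul d d y hdc hdc).symm
    rw [e1, e2, ← cfc_add (a := y) (fun t => g t * t * g t) (fun t => d t * d t)
      ((hgc.mul continuousOn_id).mul hgc) (hdc.mul hdc), ← cfc_const_one ℝ y]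
    apply cfc_congr
    intro t ht
    have h0 := hspec t ht
    have h1 : 0 < t + δ := by positivity
    simp only [hg, hd]
    have h2 := Real.mul_self_sqrt h0
    have h3 := Real.mul_self_sqrt (show 0 ≤ δ * (2 * t + δ) by positivity)
    have e : √t / (t + δ) * t * (√t / (t + δ)) +
      √(δ * (2 * t + δ)) / (t + δ) * (√(δ * (2 * t + δ)) / (t + δ)) =
      ((√t * √t) * t + (√(δ * (2 * t + δ)) * √(δ * (2 * t + δ)))) / (t + δ) ^ 2 := by
      field_simp
    rw [e, h2, h3]
    field_simp
    ring
  have hdyd : ‖cfc d y * y * cfc d y‖ ≤ 2 * δ := by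
    have e1 : cfc d y * y * cfc d y = cfc (fun t => d t * t * d t) y := by
      rw [cfc_mul (fun t => d t * t) d y (hdc.mul continuousOn_id) hdc,
        cfc_mul d (fun t => t) y hdc continuousOn_id, hid]
    rw [e1]
    apply norm_cfc_le (by positivity)
    intro t ht
    have h0 := hspec t ht
    have h1 : 0 < t + δ := by positivity
    have h3 := Real.mul_self_sqrt (show 0 ≤ δ * (2 * t + δ) by positivity)
    have e : d t * t * d t = (√(δ * (2 * t + δ)) * √(δ * (2 * t + δ))) * t / (t + δ) ^ 2 := by
      simp only [hd]; field_simp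
    rw [e, h3, Real.norm_of_nonneg (by positivity), div_le_iff₀ (by positivity)]
    have : (2 * t + δ) * t ≤ 2 * (t + δ) ^ 2 := by nlinarith
    nlinarith
  refine ⟨CFC.sqrt x * cfc g y, ?_⟩
  have e : CFC.sqrt x * cfc g y * y * star (CFC.sqrt x * cfc g y) - x
      = - (star (cfc d y * CFC.sqrt x) * (cfc d y * CFC.sqrt x)) := by
    rw [star_mul, star_mul, hsa, hgs, hds]
    have h1 : cfc g y * y * cfc g y = 1 - cfc d y * cfc d y := by rw [← hsum]; abel
    calc _ = CFC.sqrt x * (cfc g y * y * cfc g y) * CFC.sqrt x - x := by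
          simp only [mul_assoc]
      _ = CFC.sqrt x * CFC.sqrt x - x - CFC.sqrt x * cfc d y * (cfc d y * CFC.sqrt x) := by
          rw [h1]; noncomm_ring
      _ = _ := by rw [hs]; simp
  rw [e, norm_neg, CStarRing.norm_star_mul_self, ← CStarRing.norm_self_mul_star]
  have e2 : cfc d y * CFC.sqrt x * star (cfc d y * CFC.sqrt x) = star (cfc d y) * x * cfc d y := by
    rw [star_mul, hsa, hds]
    conv_rhs => rw [← hs]
    simp only [mul_assoc]
  rw [e2]
  have h4 := CStarAlgebra.norm_le_norm_of_nonneg_of_le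
    (star_left_conjugate_nonneg hx _) (star_left_conjugate_le_conjugate hxy (cfc d y))
  rw [hds] at h4 ⊢
  linarith

lemma CuntzLE.of_dom {x y : A} (hx : 0 ≤ x) (h : Dom x y) : CuntzLE x y := by
  obtain ⟨K, hK, h⟩ := h
  exact (CuntzLE.of_le hx h).trans' (CuntzLE.smul_right hK.le)

lemma CuntzEquiv.trans' {a b c : A} (h : CuntzEquiv a b) (h' : CuntzEquiv b c) :
    CuntzEquiv a c := ⟨h.1.trans' h'.1, h'.2.trans' h.2⟩

lemma CuntzEquiv.symm' {a b : A} (h : CuntzEquiv a b) : CuntzEquiv b a := ⟨h.2, h.1⟩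

lemma CuntzEquiv.unitary {u a : A} (h1 : star u * u = 1) :
    CuntzEquiv (u * a * star u) a := by
  refine ⟨CuntzLE.of_eq_conj rfl, CuntzLE.of_eq_conj (v := star u) ?_⟩
  rw [star_star]
  calc star u * (u * a * star u) * u = (star u * u) * a * (star u * u) := by
        simp only [mul_assoc]
    _ = a := by simp [h1]

end CuntzBasics

section Traces

set_option linter.unusedSectionVars false
variable {A : Type*} [CStarAlgebra A] [PartialOrder A] [StarOrderedRing A]

/-- the real part of a functional -/
noncomputable def tr (φ : A →ₗ[ℂ] ℂ) (x : A) : ℝ := (φ x).re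

variable {φ : A →ₗ[ℂ] ℂ}

lemma tr_add (x y : A) : tr φ (x + y) = tr φ x + tr φ y := by simp [tr]
lemma tr_sub (x y : A) : tr φ (x - y) = tr φ x - tr φ y := by simp [tr]
lemma tr_smul (r : ℝ) (x : A) : tr φ (r • x) = r * tr φ x := by
  have : (r • x : A) = (r : ℂ) • x := (Complex.coe_smul r x).symm
  rw [tr, this, map_smul, smul_eq_mul, Complex.re_ofReal_mul]; rfl

lemma tr_one (h : IsTracialState φ) : tr φ 1 = 1 := by simp [tr, h.1]

lemma tr_nonneg (h : IsTracialState φ) {x : A} (hx : 0 ≤ x) : 0 ≤ tr φ x := by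
  obtain ⟨b, rfl⟩ := CStarAlgebra.nonneg_iff_eq_star_mul_self.1 hx
  obtain ⟨r, hr, e⟩ := h.2.1 b
  simp [tr, e, hr]

lemma tr_mono (h : IsTracialState φ) {x y : A} (hxy : x ≤ y) : tr φ x ≤ tr φ y := by
  have := tr_nonneg h (sub_nonneg.2 hxy)
  rw [tr_sub] at this
  linarith

lemma tr_comm (h : IsTracialState φ) (x y : A) : tr φ (x * y) = tr φ (y * x) := by
  simp only [tr, h.2.2 x y]

lemma dTau_proj (φ : A →ₗ[ℂ] ℂ) {p : A} (hp : IsStarProjection p) : dTau φ p = tr φ p := by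
  unfold dTau
  apply Tendsto.limUnder_eq
  apply tendsto_const_nhds.congr'
  filter_upwards [eventually_gt_atTop 0] with n hn
  have : cfc (fun t : ℝ => t ^ ((n : ℝ)⁻¹)) p = p := by
    conv_rhs => rw [← cfc_id' ℝ p hp.isSelfAdjoint]
    apply cfc_congr
    intro t ht
    have := hp.isIdempotentElem.spectrum_subset ℝ ht
    rcases this with rfl | rfl
    · have : ((n : ℝ)⁻¹) ≠ 0 := by positivity
      simp [Real.zero_rpow this]
    · simp
  rw [this]; rfl

/-- `p` is equivalent to a subprojection of `q`. -/
lemma strict_proj (hsc : StrictComparison A) {p q : A} (hp : IsStarProjection p)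
    (hq : IsStarProjection q) (h : ∀ φ : A →ₗ[ℂ] ℂ, IsTracialState φ → tr φ p < tr φ q) :
    ∃ w : A, w * star w = p ∧ IsStarProjection (star w * w) ∧ star w * w ≤ q := by
  have h1 : CuntzLE p q := hsc p q hp.nonneg hq.nonneg (fun φ hφ => by
    rw [dTau_proj φ hp, dTau_proj φ hq]; exact h φ hφ)
  obtain ⟨w, h2, h3, h4⟩ := sub_of_cuntz hp hq.nonneg (Dom.refl p) h1
  exact ⟨w, h2, h3, (h4.proj h3 hq).2.2⟩

lemma exists_trace (hsc : StrictComparison A) [Nontrivial A] :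
    ∃ φ : A →ₗ[ℂ] ℂ, IsTracialState φ := by
  by_contra hne
  push Not at hne
  obtain ⟨w, h1, h2, h3⟩ := strict_proj hsc (IsStarProjection.one A) (IsStarProjection.zero A)
    (fun φ hφ => absurd hφ (hne φ))
  have h4 : star w * w = 0 := le_antisymm h3 h2.nonneg
  have h5 : w = 0 := (CStarRing.star_mul_self_eq_zero_iff _).1 h4
  rw [h5, zero_mul] at h1
  exact zero_ne_one h1

/-- uniform faithfulness of traces -/
theorem tr_lower (hsimple : IsSimpleCStarAlgebra A) {e : A} (he : IsStarProjection e)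
    (he0 : e ≠ 0) :
    ∃ δ : ℝ, 0 < δ ∧ ∀ φ : A →ₗ[ℂ] ℂ, IsTracialState φ → δ ≤ tr φ e := by
  let S : Set A := {x | ∃ C : ℝ, 0 ≤ C ∧ ∀ φ : A →ₗ[ℂ] ℂ, IsTracialState φ →
    tr φ (star x * x) ≤ C * tr φ e}
  have hS0 : (0 : A) ∈ S := ⟨0, le_rfl, fun φ _ => by simp [tr]⟩
  have hSadd : ∀ {x y : A}, x ∈ S → y ∈ S → x + y ∈ S := by
    rintro x y ⟨C, hC, hx⟩ ⟨D, hD, hy⟩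
    refine ⟨2 * C + 2 * D, by positivity, fun φ hφ => ?_⟩
    have h1 : star (x + y) * (x + y) ≤ (2 : ℝ) • (star x * x) + (2 : ℝ) • (star y * y) := by
      rw [← sub_nonneg]
      have : (2 : ℝ) • (star x * x) + (2 : ℝ) • (star y * y) - star (x + y) * (x + y)
          = star (x - y) * (x - y) := by
        rw [two_smul, two_smul, star_add, star_sub]; noncomm_ring
      rw [this]; exact star_mul_self_nonneg _
    have h2 := tr_mono hφ h1
    rw [tr_add, tr_smul, tr_smul] at h2
    have := hx φ hφ
    have := hy φ hφ
    linarith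
  have hSneg : ∀ {x : A}, x ∈ S → -x ∈ S := by
    rintro x ⟨C, hC, hx⟩
    exact ⟨C, hC, fun φ hφ => by simpa using hx φ hφ⟩
  have hSl : ∀ {x y : A}, y ∈ S → x * y ∈ S := by
    rintro x y ⟨C, hC, hy⟩
    refine ⟨‖star x * x‖ * C, by positivity, fun φ hφ => ?_⟩
    have h1 : star (x * y) * (x * y) ≤ ‖star x * x‖ • (star y * y) := by
      have : star (x * y) * (x * y) = star y * (star x * x) * y := by simp [mul_assoc]
      rw [this]
      exact CStarAlgebra.star_left_conjugate_le_norm_smul (IsSelfAdjoint.star_mul_self x)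
    have h2 := tr_mono hφ h1
    rw [tr_smul] at h2
    calc _ ≤ _ := h2
      _ ≤ ‖star x * x‖ * (C * tr φ e) := by gcongr; exact hy φ hφ
      _ = _ := by ring
  have hSr : ∀ {x y : A}, x ∈ S → x * y ∈ S := by
    rintro x y ⟨C, hC, hx⟩
    refine ⟨‖y * star y‖ * C, by positivity, fun φ hφ => ?_⟩
    have h0 : tr φ (star (x * y) * (x * y)) = tr φ (x * (y * star y) * star x) := by
      rw [tr_comm hφ]; congr 1; simp [mul_assoc]
    have h1 : x * (y * star y) * star x ≤ ‖y * star y‖ • (x * star x) :=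
      CStarAlgebra.star_right_conjugate_le_norm_smul (IsSelfAdjoint.mul_star_self y)
    have h2 := tr_mono hφ h1
    rw [tr_smul, tr_comm hφ x] at h2
    rw [h0]
    calc _ ≤ _ := h2
      _ ≤ ‖y * star y‖ * (C * tr φ e) := by gcongr; exact hx φ hφ
      _ = _ := by ring
  let I : TwoSidedIdeal A := TwoSidedIdeal.mk' (closure S) (subset_closure hS0)
    (fun {x y} hx hy => map_mem_closure₂ continuous_add hx hy (fun a ha b hb => hSadd ha hb))
    (fun {x} hx => map_mem_closure continuous_neg hx (fun a ha => hSneg ha))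
    (fun {x y} hy => map_mem_closure (continuous_const_mul x) hy (fun a ha => hSl ha))
    (fun {x y} hx => map_mem_closure (f := fun a => a * y) (continuous_mul_const y) hx (fun a ha => hSr ha))
  have heS : e ∈ S := ⟨1, zero_le_one, fun φ hφ => by
    rw [he.isSelfAdjoint.star_eq, (he.isIdempotentElem : e * e = e), one_mul]⟩
  have hI : ∀ x, x ∈ I ↔ x ∈ closure S := fun x => TwoSidedIdeal.mem_mk' _ _ _ _ _ _ x
  have hIc : IsClosed (I : Set A) := by
    have : (I : Set A) = closure S := TwoSidedIdeal.coe_mk' _ _ _ _ _ _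
    rw [this]; exact isClosed_closure
  rcases hsimple I hIc with h | h
  · exfalso
    have : e ∈ I := (hI e).2 (subset_closure heS)
    rw [h, TwoSidedIdeal.mem_bot] at this
    exact he0 this
  · have h1 : (1 : A) ∈ closure S := (hI 1).1 (by rw [h]; trivial)
    obtain ⟨x, ⟨C, hC, hx⟩, hdist⟩ := Metric.mem_closure_iff.1 h1 (1 / 2) (by norm_num)
    rw [dist_eq_norm] at hdist
    refine ⟨1 / (4 * (C + 1)), by positivity, fun φ hφ => ?_⟩
    have h2 : (1 : A) ≤ (2 : ℝ) • (star x * x) + (2 : ℝ) • (star (1 - x) * (1 - x)) := by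
      rw [← sub_nonneg]
      have : (2 : ℝ) • (star x * x) + (2 : ℝ) • (star (1 - x) * (1 - x)) - 1
          = star (x + x - 1) * (x + x - 1) := by
        rw [two_smul, two_smul, star_sub, star_sub, star_add, star_one]; noncomm_ring
      rw [this]; exact star_mul_self_nonneg _
    have h3 : star (1 - x) * (1 - x) ≤ (1 / 4 : ℝ) • (1 : A) := by
      apply le_smul_one_of_norm_le (IsSelfAdjoint.star_mul_self _)
      rw [CStarRing.norm_star_mul_self]
      nlinarith [norm_nonneg (1 - x)]
    have h4 := tr_mono hφ h2
    have h5 := tr_mono hφ h3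
    rw [tr_smul, tr_one hφ] at h5
    rw [tr_add, tr_smul, tr_smul, tr_one hφ] at h4
    have h6 := hx φ hφ
    have h7 := tr_nonneg hφ he.nonneg
    rw [div_le_iff₀ (by positivity)]
    nlinarith

end Traces


section Unitaries

set_option linter.unusedSectionVars false

variable {A : Type*} [CStarAlgebra A] [PartialOrder A] [StarOrderedRing A]

/-- unitaries supported under `r` -/
def UR (r : A) : Set A :=
  {u | star u * u = 1 ∧ u * star u = 1 ∧ u * (1 - r) = 1 - r ∧ (1 - r) * u = 1 - r}

lemma UR.one_mem (r : A) : (1 : A) ∈ UR r := by simp [UR]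

lemma UR.mul_mem {r u v : A} (hu : u ∈ UR r) (hv : v ∈ UR r) : u * v ∈ UR r := by
  obtain ⟨a1, a2, a3, a4⟩ := hu
  obtain ⟨b1, b2, b3, b4⟩ := hv
  refine ⟨?_, ?_, ?_, ?_⟩
  · rw [star_mul, mul_assoc, mul_mid a1, one_mul, b1]
  · rw [star_mul, mul_assoc, mul_mid b2, one_mul, a2]
  · rw [mul_assoc, b3, a3]
  · rw [← mul_assoc, a4, b4]

lemma UR.mono {r r' u : A} (h1 : r' * r = r') (h2 : r * r' = r') (hu : u ∈ UR r') : u ∈ UR r := by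
  obtain ⟨a1, a2, a3, a4⟩ := hu
  have e1 : (1 - r') * (1 - r) = 1 - r := by
    calc _ = 1 - r - r' + r' * r := by noncomm_ring
      _ = _ := by rw [h1]; abel
  have e2 : (1 - r) * (1 - r') = 1 - r := by
    calc _ = 1 - r - r' + r * r' := by noncomm_ring
      _ = _ := by rw [h2]; abel
  refine ⟨a1, a2, ?_, ?_⟩
  · rw [← e1, ← mul_assoc, a3]
  · rw [← e2, mul_assoc, a4]

/-- `p` can be moved to `q` by a path of unitaries under `r` -/
def Mv (r p q : A) : Prop := ∃ u : A, JoinedIn (UR r) 1 u ∧ u * p * star u = q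

lemma joined_mul {r u v : A} (hu : JoinedIn (UR r) 1 u) (hv : JoinedIn (UR r) 1 v) :
    JoinedIn (UR r) 1 (u * v) := by
  have := (hu.mul hv).mono (V := UR r) (by
    rintro _ ⟨x, hx, y, hy, rfl⟩
    exact UR.mul_mem hx hy)
  simpa using this

lemma Mv.refl (r p : A) : Mv r p p := ⟨1, JoinedIn.refl (UR.one_mem r), by simp⟩

lemma Mv.trans {r p q s : A} (h : Mv r p q) (h' : Mv r q s) : Mv r p s := by
  obtain ⟨u, hu, rfl⟩ := h
  obtain ⟨v, hv, rfl⟩ := h'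
  exact ⟨v * u, joined_mul hv hu, by simp [mul_assoc]⟩

lemma phase_mem {r f : A} (hf : IsStarProjection f) (h1 : f * r = f) (h2 : r * f = f)
    {z : ℂ} (hz : z * star z = 1) : 1 + (z - 1) • f ∈ UR r := by
  have hff : f * f = f := hf.isIdempotentElem
  have hfs : star f = f := hf.isSelfAdjoint
  have hst : star (1 + (z - 1) • f) = 1 + (star z - 1) • f := by simp [hfs]
  have key : ∀ a b : ℂ, a * b = 1 → (1 + (a - 1) • f) * (1 + (b - 1) • f) = 1 := by
    intro a b hab
    rw [mul_add, add_mul, add_mul, smul_mul_smul_comm, hff, mul_one, mul_one, one_mul, add_assoc,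
      ← add_smul, ← add_smul]
    have : a - 1 + (b - 1 + (a - 1) * (b - 1)) = 0 := by linear_combination hab
    rw [this]; simp
  refine ⟨?_, ?_, ?_, ?_⟩
  · rw [hst]; exact key _ _ (by rw [mul_comm]; exact hz)
  · rw [hst]; exact key _ _ hz
  · rw [add_mul, smul_mul_assoc, mul_sub f, h1]; simp
  · rw [mul_add, mul_smul_comm, sub_mul 1 r f, h2]; simp

lemma phase_joined {r f : A} (hf : IsStarProjection f) (h1 : f * r = f) (h2 : r * f = f) :
    JoinedIn (UR r) 1 (1 - (2 : ℂ) • f) := by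
  refine JoinedIn.ofLine (f := fun t : ℝ => 1 + (Complex.exp (t * Real.pi * Complex.I) - 1) • f)
    ?_ ?_ ?_ ?_
  · fun_prop
  · simp
  · simp only [Complex.ofReal_one, one_mul, Complex.exp_pi_mul_I]
    rw [sub_eq_add_neg 1, ← neg_smul]; norm_num
  · rintro _ ⟨t, -, rfl⟩
    refine phase_mem hf h1 h2 ?_
    have : star (Complex.exp (t * Real.pi * Complex.I)) = Complex.exp (-(t * Real.pi * Complex.I)) := by
      show (starRingEnd ℂ) _ = _
      rw [← Complex.exp_conj]; simp
    rw [this, ← Complex.exp_add]; simp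

lemma sym_joined {r w : A} (hw : star w = w) (hww : w * w = 1) (h1 : w * (1 - r) = 1 - r)
    (h2 : (1 - r) * w = 1 - r) : JoinedIn (UR r) 1 w := by
  have hf : IsStarProjection ((1 / 2 : ℂ) • (1 - w)) := by
    refine ⟨?_, ?_⟩
    · show _ * _ = _
      rw [smul_mul_smul_comm]
      have : (1 - w) * (1 - w) = (2 : ℂ) • (1 - w) := by
        calc _ = 1 - w - w + w * w := by noncomm_ring
          _ = _ := by rw [hww, two_smul]; abel
      rw [this, smul_smul]; norm_num
    · rw [IsSelfAdjoint, star_smul, star_sub, hw]; simp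
  have e1 : (1 - w) * r = 1 - w := by
    calc _ = w * (1 - r) - (1 - r) + (1 - w) := by noncomm_ring
      _ = _ := by rw [h1]; abel
  have e2 : r * (1 - w) = 1 - w := by
    calc _ = (1 - r) * w - (1 - r) + (1 - w) := by noncomm_ring
      _ = _ := by rw [h2]; abel
  have := phase_joined (r := r) hf (by rw [smul_mul_assoc, e1]) (by rw [mul_smul_comm, e2])
  rw [smul_smul] at this
  norm_num at this
  exact this

/-- Orthogonal flip. -/
lemma orth_flip {r p s v : A} (hp : IsStarProjection p) (hs : IsStarProjection s)
    (hpr : p * r = p) (hrp : r * p = p) (hsr : s * r = s) (hrs : r * s = s)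
    (hps : p * s = 0) (h1 : v * star v = p) (h2 : star v * v = s) : Mv r p s := by
  have hpp : p * p = p := hp.isIdempotentElem
  have hss : s * s = s := hs.isIdempotentElem
  have hpst : star p = p := hp.isSelfAdjoint
  have hsst : star s = s := hs.isSelfAdjoint
  have hsp : s * p = 0 := by
    have := congrArg star hps; simpa [hpst, hsst] using this
  have pv : p * v = v := (proj_polar hp h1).1
  have sv : s * star v = star v := (proj_polar (w := star v) hs (by rwa [star_star])).1
  have vs : v * s = v := by have := congrArg star sv; simpa [hsst] using this
  have vp : star v * p = star v := by have := congrArg star pv; simpa [hpst] using this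
  have vv : v * v = 0 := by
    calc v * v = v * s * (p * v) := by rw [vs, pv]
      _ = v * (s * p) * v := by simp only [mul_assoc]
      _ = 0 := by rw [hsp]; simp
  have vv' : star v * star v = 0 := by rw [← star_mul, vv, star_zero]
  have pvs : p * star v = 0 := by rw [← sv, mul_mid hps, zero_mul]
  have svs : s * v = 0 := by rw [← pv, mul_mid hsp, zero_mul]
  have vps : v * p = 0 := by rw [← vs, mul_assoc, hsp, mul_zero]
  have vss : star v * s = 0 := by rw [← vp, mul_assoc, hps, mul_zero]
  have rv : r * v = v := by rw [← pv, mul_mid hrp]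
  have vr : v * r = v := by rw [← vs, mul_assoc, hsr]
  have rv' : r * star v = star v := by rw [← sv, mul_mid hrs]
  have vr' : star v * r = star v := by rw [← vp, mul_assoc, hpr]
  set w := v + star v + (1 - p - s) with hw
  have hws : star w = w := by
    rw [hw]; simp only [star_add, star_sub, star_star, star_one, hpst, hsst]; abel
  have hwp : w * p = star v := by
    rw [hw]
    simp only [add_mul, sub_mul, one_mul, vps, vp, hpp, hsp]; simp
  refine ⟨w, sym_joined hws ?_ ?_ ?_, ?_⟩
  · rw [hw]
    simp only [add_mul, sub_mul, mul_add, mul_sub, one_mul, mul_one, vps, vp, hpp, hsp, hps, hss,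
      vs, vss, pv, pvs, sv, svs, vv, vv', h1, h2]
    abel
  · rw [hw]
    simp only [add_mul, sub_mul, mul_add, mul_sub, one_mul, mul_one, hpr, hsr, vr, vr']
    abel
  · rw [hw]
    simp only [add_mul, sub_mul, mul_add, mul_sub, one_mul, mul_one, hrp, hrs, rv, rv']
    abel
  · rw [hwp, hws, hw]
    simp only [mul_add, mul_sub, mul_one, vp, vss, h2, vv']
    abel

/-- inverse square roots -/
lemma inv_sqrt {g : A} {δ : ℝ} (hδ : 0 < δ) (hle : δ • (1 : A) ≤ g) :
    ∃ k : A, star k = k ∧ k * k * g = 1 ∧ ∀ x, Commute g x → Commute k x := by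
  have hg0 : 0 ≤ g := le_trans (smul_nonneg hδ.le zero_le_one) hle
  have hu : IsUnit g := by
    refine CStarAlgebra.isUnit_of_le _ hle ⟨smul_nonneg hδ.le zero_le_one, ?_⟩
    rw [← Algebra.algebraMap_eq_smul_one]
    exact (IsUnit.mk0 _ hδ.ne').map _
  have hus : IsUnit (CFC.sqrt g) := (CFC.isUnit_sqrt_iff g hg0).2 hu
  obtain ⟨u, hu'⟩ := hus
  have hss := CFC.sqrt_mul_sqrt_self g hg0
  have hsa : star (CFC.sqrt g) = CFC.sqrt g := (CFC.sqrt_nonneg g).star_eq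
  have hc' : ∀ x, Commute g x → Commute (CFC.sqrt g) x := fun x hx => hx.cfcₙ_nnreal _
  rw [← hu'] at hss hsa hc'
  have hsai : star (↑u⁻¹ : A) = ↑u⁻¹ := by
    have h1 : star (↑u⁻¹ : A) * (u : A) = 1 := by
      rw [← hsa, ← star_mul]; simp
    calc star (↑u⁻¹ : A) = star (↑u⁻¹ : A) * (u * ↑u⁻¹) := by simp
      _ = ↑u⁻¹ := by rw [← mul_assoc, h1, one_mul]
  refine ⟨↑u⁻¹, hsai, ?_, fun x hx => (hc' x hx).units_inv_left⟩
  rw [← hss]; simp [mul_assoc]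

/-- Close flip. -/
lemma close_flip {r s t : A} (hs : IsStarProjection s) (ht : IsStarProjection t)
    (hsr : s * r = s) (hrs : r * s = s) (htr : t * r = t) (hrt : r * t = t)
    (hr : IsStarProjection r)
    {δ : ℝ} (hδ : 0 < δ) (h1 : δ • s ≤ s * t * s) (h2 : δ • t ≤ t * s * t) : Mv r s t := by
  have hss : s * s = s := hs.isIdempotentElem
  have htt : t * t = t := ht.isIdempotentElem
  have hrr : r * r = r := hr.isIdempotentElem
  have hsst : star s = s := hs.isSelfAdjoint
  have htst : star t = t := ht.isSelfAdjoint
  have hrst : star r = r := hr.isSelfAdjoint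
  wlog hδ1 : δ ≤ 1 generalizing δ
  · refine this one_pos ?_ ?_ le_rfl
    · exact (smul_le_smul_of_nonneg_right (not_le.1 hδ1).le hs.nonneg).trans h1
    · exact (smul_le_smul_of_nonneg_right (not_le.1 hδ1).le ht.nonneg).trans h2
  set h := s + t - 1 with hh
  have hsa : star h = h := by rw [hh]; simp [hsst, htst]
  have hhs : h * s = t * h := by
    rw [hh]; simp only [add_mul, sub_mul, mul_add, mul_sub, one_mul, mul_one, hss, htt]; abel
  have hsh : s * h = h * t := by
    rw [hh]; simp only [add_mul, sub_mul, mul_add, mul_sub, one_mul, mul_one, hss, htt]; abel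
  have hrh : r * h = h * r := by
    rw [hh]; simp only [add_mul, sub_mul, mul_add, mul_sub, one_mul, mul_one, hsr, hrs, htr, hrt]
  have a1 : s * (1 - t) * s ≤ (1 - δ) • s := by
    have e : s * (1 - t) * s = s - s * t * s := by
      rw [mul_sub, sub_mul, mul_one, hss]
    rw [e, sub_smul, one_smul]; exact sub_le_sub_left h1 _
  have a2 : (1 - s) * t * (1 - s) ≤ (1 - δ) • (1 - s) := by
    have b1 : star (star (t * (1 - s))) * star (t * (1 - s)) ≤ (1 - δ) • (1 : A) := by
      have e : star (star (t * (1 - s))) * star (t * (1 - s)) = t - t * s * t := by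
        rw [star_star, star_mul, star_sub, star_one, hsst, htst]
        have : (1 - s) * (1 - s) = 1 - s := hs.one_sub.isIdempotentElem
        rw [mul_assoc, mul_mid this, sub_mul, one_mul, mul_sub, htt, mul_assoc]
      rw [e]
      calc t - t * s * t ≤ t - δ • t := sub_le_sub_left h2 _
        _ = (1 - δ) • t := by rw [sub_smul, one_smul]
        _ ≤ _ := smul_le_smul_of_nonneg_left ht.le_one (by linarith)
    have b2 := flip_le (by linarith) b1
    rw [star_star] at b2
    have b3 := star_left_conjugate_le_conjugate b2 (1 - s)
    have hqq : (1 - s) * (1 - s) = 1 - s := hs.one_sub.isIdempotentElem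
    rw [star_mul, star_sub, star_one, hsst, htst, mul_smul_comm, mul_one, smul_mul_assoc, hqq] at b3
    have e : (1 - s) * ((1 - s) * t * (t * (1 - s))) * (1 - s) = (1 - s) * t * (1 - s) := by
      calc _ = ((1 - s) * (1 - s)) * (t * t) * ((1 - s) * (1 - s)) := by simp only [mul_assoc]
        _ = _ := by rw [hqq, htt]
    rwa [e] at b3
  have hle : δ • (1 : A) ≤ h * h := by
    have e : h * h = 1 - (s * (1 - t) * s + (1 - s) * t * (1 - s)) := by
      rw [hh]; simp only [add_mul, sub_mul, mul_add, mul_sub, one_mul, mul_one, hss, htt]; abel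
    rw [e, le_sub_comm]
    calc _ ≤ (1 - δ) • s + (1 - δ) • (1 - s) := add_le_add a1 a2
      _ = 1 - δ • (1 : A) := by rw [← smul_add]; simp [sub_smul]
  obtain ⟨k, hk, hkk, hkc⟩ := inv_sqrt hδ hle
  have ckh : Commute k h := hkc h (by show h * h * h = h * (h * h); rw [mul_assoc])
  have cks : Commute k s := hkc s (by
    show h * h * s = s * (h * h)
    rw [mul_assoc, hhs, ← mul_assoc, ← hsh, mul_assoc])
  have ckr : Commute k r := hkc r (by
    show h * h * r = r * (h * h)
    rw [mul_assoc, ← hrh, ← mul_assoc, ← hrh, mul_assoc])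
  set w0 := h * k with hw0
  have w0s : star w0 = w0 := by rw [hw0, star_mul, hk, hsa]; exact ckh.eq
  have w0w0 : w0 * w0 = 1 := by
    rw [hw0, ← hkk]
    calc h * k * (h * k) = (h * k) * (k * h) := by rw [ckh.eq]
      _ = (k * h) * (k * h) := by rw [ckh.eq]
      _ = k * (h * k) * h := by simp only [mul_assoc]
      _ = _ := by rw [← ckh.eq]; simp only [mul_assoc]
  have w0r : r * w0 = w0 * r := by
    rw [hw0, ← mul_assoc, hrh, mul_assoc, ← ckr.eq, mul_assoc]
  have w0sw : w0 * s = t * w0 := by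
    rw [hw0, mul_assoc, cks.eq, ← mul_assoc, hhs, mul_assoc]
  clear_value w0
  clear hw0
  set w := w0 * r + (1 - r) with hw
  have hws : star w = w := by
    rw [hw, star_add, star_mul, w0s, hrst, w0r, star_sub, star_one, hrst]
  have hwr : w * (1 - r) = 1 - r := by
    rw [hw]; simp only [add_mul, sub_mul, mul_sub, one_mul, mul_one, hrr, mul_assoc]; abel
  have hrw : (1 - r) * w = 1 - r := by
    have := congrArg star hwr
    rwa [star_mul, star_sub, star_one, hrst, hws] at this
  refine ⟨w, sym_joined hws ?_ hwr hrw, ?_⟩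
  · have e3 : w0 * r * (w0 * r) = r := by
      rw [mul_assoc, mul_mid w0r, mul_assoc, hrr, mul_mid w0w0, one_mul]
    have e4 : (1 - r) * (w0 * r) = 0 := by
      rw [sub_mul, one_mul, mul_mid w0r, mul_assoc, hrr, sub_self]
    have : w * (w0 * r) = r := by
      conv_lhs => rw [hw]
      rw [add_mul, e3, e4, add_zero]
    calc w * w = w * (w0 * r) + w * (1 - r) := by rw [← mul_add]
      _ = 1 := by rw [this, hwr]; abel
  · have e1 : w * s = w0 * s := by
      rw [hw, add_mul, mul_assoc, hrs, sub_mul, one_mul, hrs, sub_self, add_zero]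
    have e2 : t * w = t * w0 := by
      rw [hw, mul_add, ← w0r, mul_mid htr, mul_sub, mul_one, htr, sub_self, add_zero]
    have e3 : w0 * t = s * w0 := by
      have := congrArg star w0sw
      simpa [w0s, hsst, htst] using this.symm
    have e4 : w * s * w = w0 * s * w0 := by
      have : s * w = s * w0 := by
        have := congrArg star e1
        simpa [w0s, hsst, hws] using this
      rw [e1, mul_assoc, this, mul_assoc]
    rw [hws, e4, w0sw, mul_assoc, w0w0, mul_one]

end Unitaries


section MoveLemma

set_option linter.unusedSectionVars false

variable {A : Type*} [CStarAlgebra A] [PartialOrder A] [StarOrderedRing A]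

/-- Murray-von Neumann equivalence in the form used below -/
def Eqv (p q : A) : Prop := ∃ w : A, w * star w = p ∧ star w * w = q

/-- algebraic form of the order on projections -/
def PLe (e p : A) : Prop := e * p = e ∧ p * e = e

lemma Eqv.refl {p : A} (hp : IsStarProjection p) : Eqv p p :=
  ⟨p, by rw [hp.isSelfAdjoint.star_eq]; exact hp.isIdempotentElem,
    by rw [hp.isSelfAdjoint.star_eq]; exact hp.isIdempotentElem⟩

lemma Eqv.symm {p q : A} (h : Eqv p q) : Eqv q p := by
  obtain ⟨w, h1, h2⟩ := h
  exact ⟨star w, by rwa [star_star], by rwa [star_star]⟩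

lemma Eqv.trans {p q s : A} (hp : IsStarProjection p) (hs : IsStarProjection s)
    (h : Eqv p q) (h' : Eqv q s) : Eqv p s := by
  obtain ⟨w, h1, h2⟩ := h
  obtain ⟨v, h3, h4⟩ := h'
  have hpp : p * p = p := hp.isIdempotentElem
  have hss : s * s = s := hs.isIdempotentElem
  refine ⟨w * v, ?_, ?_⟩
  · calc w * v * star (w * v) = w * (v * star v) * star w := by simp [mul_assoc]
      _ = w * star w * (w * star w) := by rw [h3, ← h2]; simp only [mul_assoc]
      _ = p := by rw [h1, hpp]
  · calc star (w * v) * (w * v) = star v * (star w * w) * v := by simp [mul_assoc]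
      _ = star v * v * (star v * v) := by rw [h2, ← h3]; simp only [mul_assoc]
      _ = s := by rw [h4, hss]

lemma Eqv.tr_eq {p q : A} (h : Eqv p q) {φ : A →ₗ[ℂ] ℂ} (hφ : IsTracialState φ) :
    tr φ p = tr φ q := by
  obtain ⟨w, h1, h2⟩ := h
  rw [← h1, ← h2]
  exact tr_comm hφ _ _

lemma Eqv.unitary {p u : A} (hp : IsStarProjection p) (hu : star u * u = 1) :
    Eqv p (u * p * star u) := by
  have hpp : p * p = p := hp.isIdempotentElem
  refine ⟨star (u * p), ?_, ?_⟩
  · rw [star_star, star_mul, hp.isSelfAdjoint.star_eq, mul_assoc, mul_mid hu, one_mul, hpp]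
  · rw [star_star, star_mul, hp.isSelfAdjoint.star_eq, mul_assoc, mul_mid hpp, mul_assoc]

lemma proj_conj {p u : A} (hp : IsStarProjection p) (hu : star u * u = 1) :
    IsStarProjection (u * p * star u) := by
  have hpp : p * p = p := hp.isIdempotentElem
  refine ⟨?_, ?_⟩
  · show u * p * star u * (u * p * star u) = _
    simp only [mul_assoc]
    rw [mul_mid hu, one_mul, mul_mid hpp]
  · show star _ = _
    simp [hp.isSelfAdjoint.star_eq, mul_assoc]

lemma PLe.of_dom {e p : A} (he : IsStarProjection e) (hp : IsStarProjection p) (h : Dom e p) :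
    PLe e p := ⟨(h.proj he hp).1, (h.proj he hp).2.1⟩

lemma PLe.le {e p : A} (he : IsStarProjection e) (hp : IsStarProjection p) (h : PLe e p) :
    e ≤ p := (he.le_iff_mul_eq_left hp).2 h.1

lemma PLe.trans {e p q : A} (h : PLe e p) (h' : PLe p q) : PLe e q := by
  refine ⟨?_, ?_⟩
  · rw [← h.1, mul_assoc, h'.1]
  · rw [← h.2, mul_mid h'.2]

lemma PLe.proj_sub {e p : A} (he : IsStarProjection e) (hp : IsStarProjection p) (h : PLe e p) :
    IsStarProjection (p - e) := by
  refine ⟨?_, hp.isSelfAdjoint.sub he.isSelfAdjoint⟩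
  show (p - e) * (p - e) = p - e
  have h1 : p * p = p := hp.isIdempotentElem
  have h2 : e * e = e := he.isIdempotentElem
  rw [sub_mul, mul_sub, mul_sub, h.1, h.2, h1, h2]; abel

lemma PLe.sub {e p : A} (he : IsStarProjection e) (hp : IsStarProjection p) (h : PLe e p) :
    PLe (p - e) p := by
  have h1 : p * p = p := hp.isIdempotentElem
  exact ⟨by rw [sub_mul, h.1, h1], by rw [mul_sub, h.2, h1]⟩

lemma orth_symm {p q : A} (hp : IsStarProjection p) (hq : IsStarProjection q) (h : p * q = 0) :
    q * p = 0 := by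
  have := congrArg star h
  simpa [hp.isSelfAdjoint.star_eq, hq.isSelfAdjoint.star_eq] using this

lemma proj_add {p q : A} (hp : IsStarProjection p) (hq : IsStarProjection q) (h : p * q = 0) :
    IsStarProjection (p + q) := by
  refine ⟨?_, hp.isSelfAdjoint.add hq.isSelfAdjoint⟩
  show (p + q) * (p + q) = p + q
  have h1 : p * p = p := hp.isIdempotentElem
  have h2 : q * q = q := hq.isIdempotentElem
  rw [add_mul, mul_add, mul_add, h, orth_symm hp hq h, h1, h2]; abel

/-- `e ≤ r`, `e q = 0`, gives `e ≤ r - q`. -/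
lemma PLe.sub_right {e q r : A} (he : IsStarProjection e) (hq : IsStarProjection q)
    (h : PLe e r) (h0 : e * q = 0) : PLe e (r - q) :=
  ⟨by rw [mul_sub, h.1, h0, sub_zero], by rw [sub_mul, h.2, orth_symm he hq h0, sub_zero]⟩

lemma PLe.orth {e q r : A} (hq : PLe q r) (h : PLe e (r - q)) (hr : r * r = r) (hqq : q * q = q) :
    e * q = 0 ∧ q * e = 0 := by
  constructor
  · rw [← h.1, mul_assoc, sub_mul, hq.2, hqq, sub_self, mul_zero]
  · rw [← h.2, ← mul_assoc, mul_sub, hq.1, hqq, sub_self, zero_mul]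

lemma Eqv.split {p q e : A} (hp : IsStarProjection p) (hq : IsStarProjection q)
    (h : Eqv p q) (he : IsStarProjection e) (hep : PLe e p) :
    ∃ f, IsStarProjection f ∧ PLe f q ∧ Eqv e f ∧ Eqv (p - e) (q - f) := by
  obtain ⟨w, h1, h2⟩ := h
  have hee : e * e = e := he.isIdempotentElem
  have hes : star e = e := he.isSelfAdjoint
  have key : ∀ g, IsStarProjection g → PLe g p → Eqv g (star w * g * w) := by
    intro g hg hgp
    have hgg : g * g = g := hg.isIdempotentElem
    have hgs : star g = g := hg.isSelfAdjoint
    refine ⟨g * w, ?_, ?_⟩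
    · rw [star_mul, mul_assoc, mul_mid h1, hgs, ← mul_assoc, hgp.1, hgg]
    · rw [star_mul, hgs, mul_assoc, mul_mid hgg, ← mul_assoc]
  have pw := (proj_polar hp h1).1
  have hwq : w * q = w := by rw [← h2, mul_mid h1, pw]
  have hqw : q * star w = star w := by
    have := congrArg star hwq; simpa [hq.isSelfAdjoint.star_eq] using this
  refine ⟨star w * e * w, ?_, ⟨?_, ?_⟩, key e he hep, ?_⟩
  · refine ⟨?_, ?_⟩
    · show star w * e * w * (star w * e * w) = _
      calc _ = star w * (e * (w * star w) * e) * w := by simp only [mul_assoc]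
        _ = _ := by rw [h1, hep.1, hee]
    · show star _ = _
      simp [hes, mul_assoc]
  · rw [mul_assoc, hwq]
  · rw [← mul_assoc, ← mul_assoc, hqw]
  · have := key (p - e) (hep.proj_sub he hp) (hep.sub he hp)
    have e1 : star w * (p - e) * w = q - star w * e * w := by
      rw [mul_sub, sub_mul, mul_assoc, pw, h2]
    rwa [e1] at this

lemma polar_flip {r s m : A} (hr : IsStarProjection r) (hs : IsStarProjection s)
    (hm : IsStarProjection m) (hsr : PLe s r) (hmr : PLe m r) {δ : ℝ} (hδ : 0 < δ)
    (h : δ • s ≤ s * m * s) :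
    ∃ t, IsStarProjection t ∧ PLe t m ∧ Eqv s t ∧ Mv r s t := by
  have hmm : m * m = m := hm.isIdempotentElem
  have hms : star m = m := hm.isSelfAdjoint
  have hss : star s = s := hs.isSelfAdjoint
  have h' : δ • s ≤ s * m * star m * s := by rwa [hms, mul_assoc s m m, hmm]
  obtain ⟨w, k, k', h1, h2, h3, h4, h5, h6⟩ := polar hs hδ h'
  obtain ⟨sw, ht⟩ := proj_polar hs h1
  set t := star w * w with htdef
  have hwm : w * m = w := by rw [h2, mul_assoc, mul_assoc, hmm]
  have htm : PLe t m := by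
    refine ⟨by rw [htdef, mul_assoc, hwm], ?_⟩
    have := congrArg star hwm
    rw [star_mul, hms] at this
    rw [htdef, ← mul_assoc, this]
  have hwt : w * t = w := by rw [htdef, mul_mid h1, sw]
  have hsmt : s * m * t = s * m := by rw [h3, mul_assoc, hwt]
  have hst : s * t = s * m := by rw [← hsmt, mul_assoc, htm.2]
  have h8 : δ • s ≤ s * t * s := by rw [hst]; exact h
  have htr := htm.trans hmr
  refine ⟨t, ht, htm, ⟨w, h1, rfl⟩,
    close_flip hs ht hsr.1 hsr.2 htr.1 htr.2 hr hδ h8 ?_⟩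
  have e1 : t * s * t = star w * (s * m * s) * w := by
    have hts : t * s = star w * k' := by
      have := congrArg star hst
      rw [star_mul, ht.isSelfAdjoint.star_eq, hss, h3, star_mul, h4] at this
      exact this
    have a1 : s * m * s = k' * s * k' := by
      have b1 : s * m * s = s * m * star (s * m) := by
        rw [star_mul, hms, hss, mul_assoc, mul_assoc, mul_mid hmm]
      rw [b1, h3, star_mul, h4, mul_assoc, mul_mid h1, mul_assoc]
    have hss' : s * s = s := hs.isIdempotentElem
    rw [a1]
    calc t * s * t = t * s * (s * t) := by rw [mul_assoc t s (s * t), mul_mid hss', mul_assoc]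
      _ = star w * k' * (k' * w) := by rw [hts, hst, h3]
      _ = star w * (k' * (k' * (s * w))) := by rw [sw, mul_assoc]
      _ = star w * (k' * (s * (k' * w))) := by rw [← mul_assoc k' s w, h5.eq, mul_assoc s]
      _ = _ := by simp only [mul_assoc]
  rw [e1]
  have := star_left_conjugate_le_conjugate h w
  have e2 : star w * (δ • s) * w = δ • t := by
    rw [mul_smul_comm, smul_mul_assoc, mul_assoc, sw]
  rwa [e2] at this

/-- if `δ f ≤ f q f` then `tr f ≤ tr q` -/
lemma tr_le_of_lower {f q : A} (hf : IsStarProjection f) (hq : IsStarProjection q) {δ : ℝ}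
    (hδ : 0 < δ) (h : δ • f ≤ f * q * f) {φ : A →ₗ[ℂ] ℂ} (hφ : IsTracialState φ) :
    tr φ f ≤ tr φ q := by
  have hqq : q * q = q := hq.isIdempotentElem
  obtain ⟨w, h1, h2, h3⟩ := sub_of_lower (m := q) hf hδ
    (by rwa [hq.isSelfAdjoint.star_eq, mul_assoc f q q, hqq])
  rw [hq.isSelfAdjoint.star_eq, hqq] at h3
  rw [Eqv.tr_eq ⟨w, h1, rfl⟩ hφ]
  exact tr_mono hφ (h3.proj h2 hq).2.2

theorem move (hrr0 : RealRankZero A) (hsc : StrictComparison A) {r p q : A}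
    (hr : IsStarProjection r) (hp : IsStarProjection p) (hq : IsStarProjection q)
    (hpr : PLe p r) (hqr : PLe q r) (hpq : Eqv p q)
    (htr : ∀ φ : A →ₗ[ℂ] ℂ, IsTracialState φ → 3 * tr φ p < tr φ r) : Mv r p q := by
  have hrp := hpr.proj_sub hp hr
  have hrq := hqr.proj_sub hq hr
  have hrr : r * r = r := hr.isIdempotentElem
  have hpp : p * p = p := hp.isIdempotentElem
  have hqq : q * q = q := hq.isIdempotentElem
  have hrps : star (r - p) = r - p := hrp.isSelfAdjoint
  have hrpi : (r - p) * (r - p) = r - p := hrp.isIdempotentElem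
  set x := (r - p) * (r - q) * (r - p) with hx
  have hx0 : 0 ≤ x := by
    have := star_left_conjugate_nonneg hrq.nonneg (r - p)
    rwa [hrps] at this
  have hxle : x ≤ r - p := by
    have := star_left_conjugate_le_conjugate hrq.le_one (r - p)
    rwa [hrps, mul_one, hrpi] at this
  obtain ⟨e, he, hex, hesmall⟩ := key hrr0 hx0 (show (0 : ℝ) < 1 / 2 by norm_num)
  have herp : PLe e (r - p) := PLe.of_dom he hrp (hex.trans (Dom.of_le hxle))
  have hee : e * e = e := he.isIdempotentElem
  set f := r - p - e with hf
  have hfp : IsStarProjection f := herp.proj_sub he hrp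
  have hfrp : PLe f (r - p) := herp.sub he hrp
  have hfs : star f = f := hfp.isSelfAdjoint
  have hff : f * f = f := hfp.isIdempotentElem
  have hfe : f * (1 - e) = f := by
    rw [mul_sub, mul_one, hf, sub_mul, herp.2, hee]; abel
  have hef : (1 - e) * f = f := by
    rw [sub_mul, one_mul, hf, mul_sub, herp.1, hee]; abel
  have hfr : PLe f r := hfrp.trans (hpr.sub hp hr)
  have hfup : f * (r - q) * f ≤ (1 / 2 : ℝ) • f := by
    have h1 := star_left_conjugate_le_conjugate hesmall f
    rw [hfs, mul_smul_comm, mul_one, smul_mul_assoc, hff] at h1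
    have e1 : f * ((1 - e) * x * (1 - e)) * f = f * (r - q) * f := by
      calc _ = (f * (1 - e)) * x * ((1 - e) * f) := by simp only [mul_assoc]
        _ = (f * (r - p)) * (r - q) * ((r - p) * f) := by
          rw [hfe, hef, hx]; simp only [mul_assoc]
        _ = _ := by rw [hfrp.1, hfrp.2]
    rwa [e1] at h1
  have hflow : (1 / 2 : ℝ) • f ≤ f * q * f := by
    have e1 : f * (r - q) * f = f - f * q * f := by
      rw [mul_sub f r q, sub_mul (f * r), hfr.1, hff]
    rw [e1, sub_le_comm] at hfup
    refine le_trans (le_of_eq ?_) hfup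
    rw [eq_sub_iff_add_eq, ← add_smul]; norm_num
  have htre : ∀ φ : A →ₗ[ℂ] ℂ, IsTracialState φ → tr φ p < tr φ e := by
    intro φ hφ
    have h1 := tr_le_of_lower hfp hq (by norm_num) hflow hφ
    have h2 := hpq.tr_eq hφ
    have h3 := htr φ hφ
    rw [hf, tr_sub, tr_sub] at h1
    linarith
  obtain ⟨v, hv1, hs, hse⟩ := strict_proj hsc hp he htre
  set s := star v * v with hsdef
  have hse' : PLe s e := PLe.of_dom hs he (Dom.of_le hse)
  have hsrp : PLe s (r - p) := hse'.trans herp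
  have hsr : PLe s r := hsrp.trans (hpr.sub hp hr)
  have hss : s * s = s := hs.isIdempotentElem
  obtain ⟨K, hK, hsx⟩ := (Dom.of_le hse).trans hex
  have hslow : K⁻¹ • s ≤ s * (r - q) * s := by
    have h1 := star_left_conjugate_le_conjugate hsx s
    rw [hs.isSelfAdjoint.star_eq, hss, hss, mul_smul_comm, smul_mul_assoc] at h1
    have e1 : s * x * s = s * (r - q) * s := by
      calc s * x * s = (s * (r - p)) * (r - q) * ((r - p) * s) := by
            rw [hx]; simp only [mul_assoc]
        _ = _ := by rw [hsrp.1, hsrp.2]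
    rw [e1] at h1
    have := smul_le_smul_of_nonneg_left h1 (inv_nonneg.2 hK.le)
    rwa [smul_smul, inv_mul_cancel₀ hK.ne', one_smul] at this
  obtain ⟨t, ht, htm, hst, hmv⟩ := polar_flip hr hs hrq hsr (hqr.sub hq hr) (inv_pos.2 hK) hslow
  have hps : p * s = 0 := (hpr.orth hsrp hrr hpp).2
  have m1 : Mv r p s := orth_flip hp hs hpr.1 hpr.2 hsr.1 hsr.2 hps hv1 rfl
  have htr' : PLe t r := htm.trans (hqr.sub hq hr)
  have htq : Eqv t q := by
    have h1 : Eqv s p := Eqv.symm ⟨v, hv1, rfl⟩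
    exact (hst.symm.trans ht hp h1).trans ht hq hpq
  obtain ⟨y, hy1, hy2⟩ := htq
  have m3 : Mv r t q := orth_flip ht hq htr'.1 htr'.2 hqr.1 hqr.2
    (hqr.orth htm hrr hqq).1 hy1 hy2
  exact (m1.trans hmv).trans m3

end MoveLemma


section Multi

set_option linter.unusedSectionVars false

variable {A : Type*} [CStarAlgebra A] [PartialOrder A] [StarOrderedRing A]

lemma small_pieces (hdiv : ApproximatelyDivisible A) {ε : ℝ} (hε : 0 < ε) :
    ∃ L : List A, (∀ c ∈ L, IsStarProjection c ∧
      ∀ φ : A →ₗ[ℂ] ℂ, IsTracialState φ → tr φ c < ε) ∧ L.sum = 1 := by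
  obtain ⟨N, hN⟩ := exists_nat_gt (1 / ε)
  have hN0 : (0 : ℝ) < N := lt_trans (by positivity) hN
  have hN0' : 0 < N := by exact_mod_cast hN0
  obtain ⟨Φ, -⟩ := hdiv N hN0'
  set θ := Φ 0 with hθ
  let E : Fin N → Fin N → A := fun i j => θ (Matrix.single i j 1, 0)
  let F : Fin (N + 1) → Fin (N + 1) → A := fun i j => θ (0, Matrix.single i j 1)
  have hE : ∀ i j k, E i j * E j k = E i k := by
    intro i j k
    simp only [E, ← map_mul, Prod.mk_mul_mk, Matrix.single_mul_single_same, mul_zero, mul_one]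
  have hF : ∀ i j k, F i j * F j k = F i k := by
    intro i j k
    simp only [F, ← map_mul, Prod.mk_mul_mk, Matrix.single_mul_single_same, mul_zero, mul_one]
  have hEs : ∀ i j, star (E i j) = E j i := by
    intro i j
    simp only [E, ← map_star]
    congr 1
    ext a b <;> simp [Matrix.single_apply, and_comm, apply_ite]
  have hFs : ∀ i j, star (F i j) = F j i := by
    intro i j
    simp only [F, ← map_star]
    congr 1
    ext a b <;> simp [Matrix.single_apply, and_comm, apply_ite]
  have hEp : ∀ i, IsStarProjection (E i i) := fun i => ⟨hE i i i, hEs i i⟩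
  have hFp : ∀ i, IsStarProjection (F i i) := fun i => ⟨hF i i i, hFs i i⟩
  have hsum : ∑ i, E i i + ∑ i, F i i = 1 := by
    simp only [E, F, ← map_sum, ← map_add]
    rw [← map_one θ]
    congr 1
    ext i j
    · simp [Prod.fst_sum, Matrix.sum_single_one]
    · simp [Prod.snd_sum, Matrix.sum_single_one]
  have trsum : ∀ (φ : A →ₗ[ℂ] ℂ) (n : ℕ) (c : Fin n → A), tr φ (∑ i, c i) = ∑ i, tr φ (c i) := by
    intro φ n c
    simp [tr, map_sum]
  have hle : ∀ φ : A →ₗ[ℂ] ℂ, IsTracialState φ → ∑ i, tr φ (E i i) + ∑ i, tr φ (F i i) = 1 := by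
    intro φ hφ
    rw [← trsum, ← trsum, ← tr_add, hsum, tr_one hφ]
  have hEtr : ∀ i, ∀ φ : A →ₗ[ℂ] ℂ, IsTracialState φ → tr φ (E i i) < ε := by
    intro i φ hφ
    have h1 : ∀ j, tr φ (E j j) = tr φ (E i i) := fun j => by
      rw [← hE j i j, tr_comm hφ, hE]
    have h2 := hle φ hφ
    have h3 : 0 ≤ ∑ i, tr φ (F i i) := Finset.sum_nonneg fun j _ => tr_nonneg hφ (hFp j).nonneg
    simp only [h1, Finset.sum_const, Finset.card_univ, Fintype.card_fin, nsmul_eq_mul] at h2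
    rw [div_lt_iff₀ hε] at hN
    by_contra hc
    push Not at hc
    nlinarith
  have hFtr : ∀ i, ∀ φ : A →ₗ[ℂ] ℂ, IsTracialState φ → tr φ (F i i) < ε := by
    intro i φ hφ
    have h1 : ∀ j, tr φ (F j j) = tr φ (F i i) := fun j => by
      rw [← hF j i j, tr_comm hφ, hF]
    have h2 := hle φ hφ
    have h3 : 0 ≤ ∑ i, tr φ (E i i) := Finset.sum_nonneg fun j _ => tr_nonneg hφ (hEp j).nonneg
    simp only [h1, Finset.sum_const, Finset.card_univ, Fintype.card_fin, nsmul_eq_mul] at h2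
    push_cast at h2
    rw [div_lt_iff₀ hε] at hN
    by_contra hc
    push Not at hc
    nlinarith
  refine ⟨(List.finRange N).map (fun i => E i i) ++ (List.finRange (N + 1)).map (fun i => F i i),
    ?_, ?_⟩
  · intro c hc
    rw [List.mem_append, List.mem_map, List.mem_map] at hc
    rcases hc with ⟨i, -, rfl⟩ | ⟨i, -, rfl⟩
    · exact ⟨hEp i, hEtr i⟩
    · exact ⟨hFp i, hFtr i⟩
  · rw [List.sum_append, ← hsum]
    congr 1 <;> rw [← List.ofFn_eq_map, List.sum_ofFn]

lemma UR.comm {r u : A} (hu : u ∈ UR r) : u * r = r * u := by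
  obtain ⟨-, -, h1, h2⟩ := hu
  have := h1.trans h2.symm
  rw [mul_sub, sub_mul, mul_one, one_mul] at this
  exact sub_right_injective this

lemma UR.comm' {r u : A} (hr : IsStarProjection r) (hu : u ∈ UR r) :
    star u * r = r * star u := by
  have := congrArg star (UR.comm hu)
  simpa [hr.isSelfAdjoint.star_eq] using this.symm

lemma PLe.conj {r u p : A} (hr : IsStarProjection r) (hu : u ∈ UR r) (hp : PLe p r) :
    PLe (u * p * star u) r := by
  constructor
  · rw [mul_assoc, UR.comm' hr hu, mul_assoc, mul_mid hp.1, ← mul_assoc]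
  · rw [← mul_assoc, ← mul_assoc, ← (UR.comm hu), mul_assoc u, hp.2]

/-- splitting a projection below a sum of two projections -/
lemma cut (hrr0 : RealRankZero A) {p c C : A} (hp : IsStarProjection p) (hc : IsStarProjection c)
    (hC : 0 ≤ C) (h : Dom p (c + C)) :
    ∃ e, IsStarProjection e ∧ PLe e p ∧
      (∀ φ : A →ₗ[ℂ] ℂ, IsTracialState φ → tr φ e ≤ tr φ c) ∧
      ∃ p', IsStarProjection p' ∧ Eqv (p - e) p' ∧ Dom p' C := by
  obtain ⟨K, hK, h⟩ := h
  have hps : star p = p := hp.isSelfAdjoint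
  have hpp : p * p = p := hp.isIdempotentElem
  set x := p * c * p with hx
  have hx0 : 0 ≤ x := by
    have := star_left_conjugate_nonneg hc.nonneg p
    rwa [hps] at this
  have hxle : x ≤ p := by
    have := star_left_conjugate_le_conjugate hc.le_one p
    rwa [hps, mul_one, hpp] at this
  obtain ⟨e, he, hex, hesmall⟩ := key hrr0 hx0 (show (0 : ℝ) < 1 / (2 * K) by positivity)
  have hep : PLe e p := PLe.of_dom he hp (hex.trans (Dom.of_le hxle))
  have hee : e * e = e := he.isIdempotentElem
  refine ⟨e, he, hep, ?_, ?_⟩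
  · intro φ hφ
    obtain ⟨K2, hK2, h2⟩ := hex
    have h1 := star_left_conjugate_le_conjugate h2 e
    rw [he.isSelfAdjoint.star_eq, hee, hee, mul_smul_comm, smul_mul_assoc] at h1
    have e1 : e * x * e = e * c * e := by
      calc e * x * e = (e * p) * c * (p * e) := by rw [hx]; simp only [mul_assoc]
        _ = _ := by rw [hep.1, hep.2]
    rw [e1] at h1
    have := smul_le_smul_of_nonneg_left h1 (inv_nonneg.2 hK2.le)
    rw [smul_smul, inv_mul_cancel₀ hK2.ne', one_smul] at this
    exact tr_le_of_lower he hc (inv_pos.2 hK2) this hφ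
  · have hf : IsStarProjection (p - e) := hep.proj_sub he hp
    have hfp : PLe (p - e) p := hep.sub he hp
    have hfe : (p - e) * (1 - e) = p - e := by
      rw [mul_sub, mul_one, sub_mul, hep.2, hee]; abel
    have hef : (1 - e) * (p - e) = p - e := by
      rw [sub_mul, one_mul, mul_sub, hep.1, hee]; abel
    set f := p - e with hfdef
    clear_value f
    have hff : f * f = f := hf.isIdempotentElem
    have hfs : star f = f := hf.isSelfAdjoint
    have h1 := star_left_conjugate_le_conjugate hesmall f
    rw [hfs, mul_smul_comm, mul_one, smul_mul_assoc, hff] at h1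
    have e1 : f * ((1 - e) * x * (1 - e)) * f = f * c * f := by
      calc _ = (f * (1 - e)) * x * ((1 - e) * f) := by simp only [mul_assoc]
        _ = (f * p) * c * (p * f) := by
          rw [hfe, hef, hx]; simp only [mul_assoc]
        _ = _ := by rw [hfp.1, hfp.2]
    rw [e1] at h1
    have h2 := star_left_conjugate_le_conjugate h f
    rw [hfs, hfp.1, hff, mul_smul_comm, smul_mul_assoc, mul_add, add_mul, smul_add] at h2
    have h3 : f ≤ (1 / 2 : ℝ) • f + K • (f * C * f) := by
      refine h2.trans (add_le_add ?_ le_rfl)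
      have := smul_le_smul_of_nonneg_left h1 hK.le
      rw [smul_smul] at this
      refine this.trans (le_of_eq ?_)
      congr 1; field_simp
    have h4 : (1 / 2 : ℝ) • f ≤ K • (f * C * f) := by
      rw [← sub_le_iff_le_add'] at h3
      refine le_trans (le_of_eq ?_) h3
      rw [eq_sub_iff_add_eq, ← add_smul]; norm_num
    have h5 := smul_le_smul_of_nonneg_left h4 (inv_nonneg.2 hK.le)
    rw [smul_smul, smul_smul, inv_mul_cancel₀ hK.ne', one_smul] at h5
    have hs := CFC.sqrt_mul_sqrt_self C hC
    have hsa : star (CFC.sqrt C) = CFC.sqrt C := (CFC.sqrt_nonneg C).star_eq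
    obtain ⟨w, a1, a2, a3⟩ := sub_of_lower (m := CFC.sqrt C) hf
      (show (0 : ℝ) < K⁻¹ * (1 / 2) by positivity)
      (by rw [hsa, mul_assoc f, hs]; exact h5)
    rw [hsa, hs] at a3
    exact ⟨_, a2, ⟨w, a1, rfl⟩, a3⟩

lemma Eqv.eq_zero {p : A} (h : Eqv p 0) : p = 0 := by
  obtain ⟨w, h1, h2⟩ := h
  rw [CStarRing.star_mul_self_eq_zero_iff] at h2
  rw [← h1, h2, zero_mul]

theorem multi_aux (hrr0 : RealRankZero A) (hsc : StrictComparison A) {δ : ℝ} (L : List A) :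
    (∀ c ∈ L, IsStarProjection c ∧ ∀ φ : A →ₗ[ℂ] ℂ, IsTracialState φ → tr φ c < δ) →
    ∀ r p q p' : A, IsStarProjection r → IsStarProjection p → IsStarProjection q →
    IsStarProjection p' → PLe p r → PLe q r → Eqv p q → Eqv p' p → Dom p' L.sum →
    (∀ φ : A →ₗ[ℂ] ℂ, IsTracialState φ → 2 * δ ≤ tr φ (r - q)) → Mv r p q := by
  induction L with
  | nil =>
    intro _ r p q p' hr hp hq hp' hpr hqr hpq hp'p hdom _
    obtain ⟨K, hK, h⟩ := hdom
    simp only [List.sum_nil, smul_zero] at h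
    have h0 : p' = 0 := le_antisymm h hp'.nonneg
    subst h0
    have h1 : p = 0 := hp'p.symm.eq_zero
    subst h1
    have h2 : q = 0 := hpq.symm.eq_zero
    subst h2
    exact Mv.refl _ _
  | cons c L ih =>
    intro hL r p q p' hr hp hq hp' hpr hqr hpq hp'p hdom htr
    have hL' : ∀ c ∈ L, IsStarProjection c ∧
        ∀ φ : A →ₗ[ℂ] ℂ, IsTracialState φ → tr φ c < δ :=
      fun d hd => hL d (List.mem_cons_of_mem _ hd)
    obtain ⟨hc, hctr⟩ := hL c List.mem_cons_self
    have hC : 0 ≤ L.sum := List.sum_nonneg fun d hd => (hL' d hd).1.nonneg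
    rw [List.sum_cons] at hdom
    obtain ⟨e, he, hep', hetr, p'', hp'', hpp'', hdom''⟩ := cut hrr0 hp' hc hC hdom
    obtain ⟨ep, hep, hepp, heep, hrest⟩ := hp'p.split hp' hp he hep'
    obtain ⟨eq, heq, heqq, hepeq, hrest2⟩ := hpq.split hp hq hep hepp
    have hepr := hepp.trans hpr
    have heqr := heqq.trans hqr
    have mv1 : Mv r ep eq := by
      refine move hrr0 hsc hr hep heq hepr heqr hepeq ?_
      intro φ hφ
      have h1 := htr φ hφ
      rw [tr_sub] at h1
      have h2 := hepeq.tr_eq hφ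
      have h3 := heep.tr_eq hφ
      have h4 := hetr φ hφ
      have h5 := hctr φ hφ
      have h6 := tr_mono hφ (heqq.le heq hq)
      linarith
    obtain ⟨u, hu, hue⟩ := mv1
    have hum := hu.target_mem
    have hp1 : IsStarProjection (p - ep) := hepp.proj_sub hep hp
    have hq1 : IsStarProjection (q - eq) := heqq.proj_sub heq hq
    have hr1 : IsStarProjection (r - eq) := heqr.proj_sub heq hr
    have hp3 := proj_conj hp1 hum.1
    have hp13 := Eqv.unitary hp1 hum.1
    have hepep : ep * ep = ep := hep.isIdempotentElem
    have heqeq : eq * eq = eq := heq.isIdempotentElem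
    have hp3r : PLe (u * (p - ep) * star u) (r - eq) := by
      refine (PLe.conj hr hum ((hepp.sub hep hp).trans hpr)).sub_right hp3 heq ?_
      rw [← hue]
      simp only [mul_assoc]
      rw [mul_mid hum.1, one_mul, ← mul_assoc (p - ep), sub_mul, hepp.2, hepep, sub_self, zero_mul,
        mul_zero]
    have hq1r : PLe (q - eq) (r - eq) := by
      refine ((heqq.sub heq hq).trans hqr).sub_right hq1 heq ?_
      rw [sub_mul, heqq.2, heqeq, sub_self]
    obtain ⟨v, hv, hve⟩ := ih hL' (r - eq) _ (q - eq) p'' hr1 hp3 hq1 hp'' hp3r hq1r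
      (hp13.symm.trans hp3 hq1 hrest2)
      ((hpp''.symm.trans hp'' hp1 hrest).trans hp'' hp3 hp13) hdom'' (by
        intro φ hφ
        rw [sub_sub_sub_cancel_right]
        exact htr φ hφ)
    have hvm := hv.target_mem
    have hreq : (1 - (r - eq)) * eq = eq := by
      rw [sub_mul, one_mul, sub_mul, heqr.2, heqeq, sub_self, sub_zero]
    have hveq : v * eq = eq := by
      rw [← hreq, ← mul_assoc, hvm.2.2.1]
    have hveq' : eq * star v = eq := by
      have := congrArg star hveq
      simpa [heq.isSelfAdjoint.star_eq] using this
    refine ⟨v * u, joined_mul (hv.mono fun x hx => ?_) hu, ?_⟩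
    · have h := heqr.sub heq hr
      exact UR.mono h.1 h.2 hx
    · calc v * u * p * star (v * u)
          = v * (u * (p - ep) * star u) * star v + v * (u * ep * star u) * star v := by
            rw [star_mul]; noncomm_ring
        _ = q := by rw [hve, hue, hveq, hveq']; abel

theorem multi (hsimple : IsSimpleCStarAlgebra A) (hdiv : ApproximatelyDivisible A)
    (hrr0 : RealRankZero A) (hsc : StrictComparison A) {r p q : A}
    (hr : IsStarProjection r) (hp : IsStarProjection p) (hq : IsStarProjection q)
    (hpr : PLe p r) (hqr : PLe q r) (hpq : Eqv p q) : Mv r p q := by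
  by_cases h0 : r - q = 0
  · have hrq : r = q := sub_eq_zero.1 h0
    subst hrq
    by_cases h1 : r - p = 0
    · have : r = p := sub_eq_zero.1 h1
      subst this
      exact Mv.refl _ _
    · exfalso
      have : Nontrivial A := ⟨_, _, h1⟩
      obtain ⟨δ, hδ, h⟩ := tr_lower hsimple (hpr.proj_sub hp hr) h1
      obtain ⟨φ, hφ⟩ := exists_trace hsc
      have h2 := h φ hφ
      rw [tr_sub, hpq.tr_eq hφ] at h2
      linarith
  · obtain ⟨δ, hδ, h⟩ := tr_lower hsimple (hqr.proj_sub hq hr) h0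
    obtain ⟨L, hL, hsum⟩ := small_pieces hdiv (show 0 < δ / 2 by positivity)
    refine multi_aux hrr0 hsc L hL r p q p hr hp hq hp hpr hqr hpq (Eqv.refl hp) ?_ ?_
    · rw [hsum]; exact Dom.of_le hp.le_one
    · intro φ hφ
      have := h φ hφ
      linarith

end Multi


section Steps

set_option linter.unusedSectionVars false

variable {A : Type*} [CStarAlgebra A] [PartialOrder A] [StarOrderedRing A]

lemma conj_nonneg {a E : A} (ha : 0 ≤ a) (hE : IsStarProjection E) : 0 ≤ E * a * E := by
  have := star_left_conjugate_nonneg ha E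
  rwa [hE.isSelfAdjoint.star_eq] at this

lemma conj_le {a b E : A} (h : a ≤ b) (hE : IsStarProjection E) : E * a * E ≤ E * b * E := by
  have := star_left_conjugate_le_conjugate h E
  rwa [hE.isSelfAdjoint.star_eq] at this

lemma conj_le_norm {a E : A} (ha : 0 ≤ a) (hE : IsStarProjection E) : E * a * E ≤ ‖a‖ • E := by
  have h := conj_le (le_norm_smul_one ha.isSelfAdjoint) hE
  have hEE : E * E = E := hE.isIdempotentElem
  rwa [mul_smul_comm, mul_one, smul_mul_assoc, hEE] at h

lemma conj_smul_one {E : A} (hE : IsStarProjection E) (r : ℝ) : E * (r • (1 : A)) * E = r • E := by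
  have hEE : E * E = E := hE.isIdempotentElem
  rw [mul_smul_comm, mul_one, smul_mul_assoc, hEE]

lemma dom_conj {a E : A} (ha : 0 ≤ a) (hE : IsStarProjection E) : Dom (E * a * E) E :=
  ⟨‖a‖ + 1, by positivity, (conj_le_norm ha hE).trans
    (smul_le_smul_of_nonneg_right (by linarith) hE.nonneg)⟩

lemma dom_corner {a E : A} (ha : 0 ≤ a) (hE : IsStarProjection E) (h : Dom E a) :
    Dom ((1 - E) * a * (1 - E)) a := by
  have h1 : (1 - E) * a * (1 - E) ≤ (2 : ℝ) • a + (2 : ℝ) • (E * a * E) := by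
    have e : (2 : ℝ) • a + (2 : ℝ) • (E * a * E)
        = (1 - E) * a * (1 - E) + (1 + E) * a * (1 + E) := by
      rw [two_smul, two_smul]; noncomm_ring
    rw [e, le_add_iff_nonneg_right]
    have := star_left_conjugate_nonneg ha (1 + E)
    rwa [star_add, star_one, hE.isSelfAdjoint.star_eq] at this
  refine (Dom.of_le h1).trans (Dom.add ?_ ?_)
  · exact Dom.smul ha (Dom.refl a) (by norm_num)
  · exact Dom.smul ha ((dom_conj ha hE).trans h) (by norm_num)

lemma corner_key (hrr0 : RealRankZero A) {a E : A} (ha : 0 ≤ a) (hE : IsStarProjection E)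
    (h : Dom E a) {ε : ℝ} (hε : 0 < ε) :
    ∃ p, IsStarProjection p ∧ E * p = 0 ∧ Dom p a ∧
      (1 - (E + p)) * a * (1 - (E + p)) ≤ ε • (1 : A) := by
  have hEE : E * E = E := hE.isIdempotentElem
  obtain ⟨p, hp, hpx, hle⟩ := key hrr0 (conj_nonneg ha hE.one_sub) hε
  have hpE : p * E = 0 := by
    refine hpx.kill hp.nonneg ?_
    rw [mul_assoc, sub_mul 1 E E, one_mul, hEE, sub_self, mul_zero]
  have hEp := orth_symm hp hE hpE
  refine ⟨p, hp, hEp, hpx.trans (dom_corner ha hE h), ?_⟩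
  have e1 : (1 - p) * (1 - E) = 1 - (E + p) := by
    calc _ = 1 - E - p + p * E := by noncomm_ring
      _ = _ := by rw [hpE]; abel
  have e2 : (1 - E) * (1 - p) = 1 - (E + p) := by
    calc _ = 1 - E - p + E * p := by noncomm_ring
      _ = _ := by rw [hEp]; abel
  have e3 : (1 - p) * ((1 - E) * a * (1 - E)) * (1 - p)
      = ((1 - p) * (1 - E)) * a * ((1 - E) * (1 - p)) := by simp only [mul_assoc]
  rwa [e3, e1, e2] at hle

lemma corner_nonzero (hrr0 : RealRankZero A) {a E : A} (ha : 0 ≤ a) (hE : IsStarProjection E)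
    (h : Dom E a) (hne : (1 - E) * a * (1 - E) ≠ 0) :
    ∃ p, IsStarProjection p ∧ E * p = 0 ∧ Dom p a ∧ p ≠ 0 := by
  have hpos : 0 < ‖(1 - E) * a * (1 - E)‖ := norm_pos_iff.2 hne
  obtain ⟨p, hp, h1, h2, h3⟩ := corner_key hrr0 ha hE h
    (show 0 < ‖(1 - E) * a * (1 - E)‖ / 2 by positivity)
  refine ⟨p, hp, h1, h2, ?_⟩
  rintro rfl
  rw [add_zero] at h3
  have := norm_le_of_le_smul_one (by positivity) (conj_nonneg ha hE.one_sub) h3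
  linarith

lemma Eqv.add {p q p' q' : A} (hq : IsStarProjection q) (hq' : IsStarProjection q')
    (hp : IsStarProjection p) (hp' : IsStarProjection p')
    (h : Eqv p q) (h' : Eqv p' q') (h0 : p * p' = 0) (h0' : q * q' = 0) :
    Eqv (p + p') (q + q') := by
  obtain ⟨w, h1, h2⟩ := h
  obtain ⟨v, h3, h4⟩ := h'
  have pw := (proj_polar hp h1).1
  have pv := (proj_polar hp' h3).1
  have qw := (proj_polar (w := star w) hq (by rwa [star_star])).1
  have qv := (proj_polar (w := star v) hq' (by rwa [star_star])).1
  have wq : w * q = w := by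
    have := congrArg star qw; simpa [hq.isSelfAdjoint.star_eq] using this
  have wp : star w * p = star w := by
    have := congrArg star pw; simpa [hp.isSelfAdjoint.star_eq] using this
  have x1 : w * star v = 0 := by
    rw [← wq, ← qv, mul_assoc, mul_mid h0', zero_mul, mul_zero]
  have x2 : star w * v = 0 := by
    rw [← wp, ← pv, mul_assoc, mul_mid h0, zero_mul, mul_zero]
  have x3 : v * star w = 0 := by have := congrArg star x1; simpa using this
  have x4 : star v * w = 0 := by have := congrArg star x2; simpa using this
  refine ⟨w + v, ?_, ?_⟩
  · rw [star_add, add_mul, mul_add, mul_add, h1, h3, x1, x3]; abel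
  · rw [star_add, add_mul, mul_add, mul_add, h2, h4, x2, x4]; abel

theorem step (hsimple : IsSimpleCStarAlgebra A) (hrr0 : RealRankZero A) (hsc : StrictComparison A)
    {a b E F : A} (ha : 0 ≤ a) (hb : 0 ≤ b) (hab : CuntzLE a b)
    (hE : IsStarProjection E) (hF : IsStarProjection F)
    (htr : ∀ φ : A →ₗ[ℂ] ℂ, IsTracialState φ → tr φ E = tr φ F)
    (hEa : Dom E a) (hFb : Dom F b)
    (hne : ∀ G, IsStarProjection G → Dom G a → (1 - G) * a * (1 - G) ≠ 0)
    {ε : ℝ} (hε : 0 < ε) :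
    ∃ p q, IsStarProjection p ∧ IsStarProjection q ∧ Eqv p q ∧ E * p = 0 ∧ F * q = 0 ∧
      Dom p a ∧ Dom q b ∧ (1 - (E + p)) * a * (1 - (E + p)) ≤ ε • (1 : A) := by
  obtain ⟨p, hp, hEp, hpa, hsmall⟩ := corner_key hrr0 ha hE hEa hε
  have hEp1 := proj_add hE hp hEp
  have hEpa := hEa.add hpa
  obtain ⟨p', hp', hEp', hpa', hp0'⟩ := corner_nonzero hrr0 ha hEp1 hEpa (hne _ hEp1 hEpa)
  have hG0 := proj_add hEp1 hp' hEp'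
  obtain ⟨w, hw1, hG', K, hK, hGb⟩ := sub_of_cuntz hG0 hb (hEpa.add hpa') hab
  obtain ⟨e, he, hFe, heb, hesmall⟩ := corner_key hrr0 hb hF hFb
    (show (0 : ℝ) < 1 / (2 * K) by positivity)
  have hG := proj_add hF he hFe
  have heqv : Eqv (E + p + p') (star w * w) := ⟨w, hw1, rfl⟩
  set G' := star w * w with hG'def
  set G := F + e with hGdef
  have hGs : star G = G := hG.isSelfAdjoint
  have hGs' : star G' = G' := hG'.isSelfAdjoint
  have hGG : (1 - G) * (1 - G) = 1 - G := hG.one_sub.isIdempotentElem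
  have hGG' : G' * G' = G' := hG'.isIdempotentElem
  have h1 : (1 - G) * G' * (1 - G) ≤ (1 / 2 : ℝ) • (1 : A) := by
    refine (conj_le hGb hG.one_sub).trans ?_
    rw [mul_smul_comm, smul_mul_assoc]
    refine (smul_le_smul_of_nonneg_left hesmall hK.le).trans (le_of_eq ?_)
    rw [smul_smul]; congr 1; field_simp
  have h2 : G' * (1 - G) * G' ≤ (1 / 2 : ℝ) • (1 : A) := by
    have e1 : star (G' * (1 - G)) * (G' * (1 - G)) = (1 - G) * G' * (1 - G) := by
      rw [star_mul, star_sub, star_one, hGs, hGs', mul_assoc, mul_mid hGG', ← mul_assoc]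
    have e2 : G' * (1 - G) * star (G' * (1 - G)) = G' * (1 - G) * G' := by
      rw [star_mul, star_sub, star_one, hGs, hGs', mul_assoc, mul_mid hGG, ← mul_assoc]
    rw [← e1] at h1
    have := flip_le (by norm_num) h1
    rwa [e2] at this
  have h3 : (1 / 2 : ℝ) • G' ≤ G' * G * G' := by
    have h4 := conj_le h2 hG'
    have e1 : G' * (G' * (1 - G) * G') * G' = G' - G' * G * G' := by
      calc _ = (G' * G') * (1 - G) * (G' * G') := by simp only [mul_assoc]
        _ = _ := by rw [hGG', mul_sub, sub_mul, mul_one, hGG']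
    rw [e1, conj_smul_one hG', sub_le_comm] at h4
    refine le_trans (le_of_eq ?_) h4
    rw [eq_sub_iff_add_eq, ← add_smul]; norm_num
  obtain ⟨δ, hδ, hlow⟩ := tr_lower hsimple hp' hp0'
  obtain ⟨v, hv1, hq, hqe⟩ := strict_proj hsc hp he (by
    intro φ hφ
    have t1 := tr_le_of_lower hG' hG (by norm_num) h3 hφ
    have t2 := heqv.tr_eq hφ
    have t3 := htr φ hφ
    have t4 := hlow φ hφ
    rw [hGdef, tr_add] at t1
    rw [tr_add, tr_add] at t2
    linarith)
  have hqe' := PLe.of_dom hq he (Dom.of_le hqe)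
  refine ⟨p, star v * v, hp, hq, ⟨v, hv1, rfl⟩, hEp, ?_, hpa, (Dom.of_le hqe).trans heb, hsmall⟩
  rw [← hqe'.2, mul_mid hFe, zero_mul]

lemma residual_mono {a E p : A} (hE : IsStarProjection E) (hp : IsStarProjection p)
    (h0 : E * p = 0) {ε : ℝ} (hε : 0 ≤ ε) (h : (1 - E) * a * (1 - E) ≤ ε • (1 : A)) :
    (1 - (E + p)) * a * (1 - (E + p)) ≤ ε • (1 : A) := by
  have h1 := conj_le h hp.one_sub
  have h0' := orth_symm hE hp h0
  have e1 : (1 - p) * (1 - E) = 1 - (E + p) := by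
    calc _ = 1 - E - p + p * E := by noncomm_ring
      _ = _ := by rw [h0']; abel
  have e2 : (1 - E) * (1 - p) = 1 - (E + p) := by
    calc _ = 1 - E - p + E * p := by noncomm_ring
      _ = _ := by rw [h0]; abel
  have e3 : (1 - p) * ((1 - E) * a * (1 - E)) * (1 - p)
      = ((1 - p) * (1 - E)) * a * ((1 - E) * (1 - p)) := by simp only [mul_assoc]
  rw [e3, e1, e2, conj_smul_one hp.one_sub] at h1
  exact h1.trans (smul_le_smul_of_nonneg_left hp.one_sub.le_one hε)

theorem bistep (hsimple : IsSimpleCStarAlgebra A) (hrr0 : RealRankZero A)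
    (hsc : StrictComparison A)
    {a b E F : A} (ha : 0 ≤ a) (hb : 0 ≤ b) (hab : CuntzEquiv a b)
    (hE : IsStarProjection E) (hF : IsStarProjection F)
    (htr : ∀ φ : A →ₗ[ℂ] ℂ, IsTracialState φ → tr φ E = tr φ F)
    (hEa : Dom E a) (hFb : Dom F b)
    (hne : ∀ G, IsStarProjection G → Dom G a → (1 - G) * a * (1 - G) ≠ 0)
    (hne' : ∀ G, IsStarProjection G → Dom G b → (1 - G) * b * (1 - G) ≠ 0)
    {ε : ℝ} (hε : 0 < ε) :
    ∃ p q, IsStarProjection p ∧ IsStarProjection q ∧ Eqv p q ∧ E * p = 0 ∧ F * q = 0 ∧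
      Dom p a ∧ Dom q b ∧ (1 - (E + p)) * a * (1 - (E + p)) ≤ ε • (1 : A) ∧
      (1 - (F + q)) * b * (1 - (F + q)) ≤ ε • (1 : A) := by
  obtain ⟨p, q, hp, hq, hpq, hEp, hFq, hpa, hqb, hs1⟩ :=
    step hsimple hrr0 hsc ha hb hab.1 hE hF htr hEa hFb hne hε
  have hE1 := proj_add hE hp hEp
  have hF1 := proj_add hF hq hFq
  obtain ⟨q', p', hq', hp', hqp', hFq', hEp', hqb', hpa', hs2⟩ :=
    step hsimple hrr0 hsc hb ha hab.2 hF1 hE1 (fun φ hφ => by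
      rw [tr_add, tr_add, htr φ hφ, hpq.tr_eq hφ]) (hFb.add hqb) (hEa.add hpa) hne' hε
  have aux : ∀ E p p' : A, IsStarProjection p → (E * p = 0) → (E * E = E) →
      (E + p) * p' = 0 → E * p' = 0 ∧ p * p' = 0 := by
    intro E p p' hp h0 hEE h
    have h1 : E * p' = 0 := by
      have := congrArg (E * ·) h
      simp only [mul_zero] at this
      rwa [← mul_assoc, mul_add, hEE, h0, add_zero] at this
    rw [add_mul, h1, zero_add] at h
    exact ⟨h1, h⟩
  obtain ⟨x1, x2⟩ := aux E p p' hp hEp hE.isIdempotentElem hEp'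
  obtain ⟨y1, y2⟩ := aux F q q' hq hFq hF.isIdempotentElem hFq'
  refine ⟨p + p', q + q', proj_add hp hp' x2, proj_add hq hq' y2,
    Eqv.add hq hq' hp hp' hpq hqp'.symm x2 y2, by rw [mul_add, hEp, x1, add_zero],
    by rw [mul_add, hFq, y1, add_zero], hpa.add hpa', hqb.add hqb', ?_, ?_⟩
  · rw [← add_assoc]; exact residual_mono hE1 hp' hEp' hε.le hs1
  · rw [← add_assoc]; exact hs2

/-- the sequence data -/
theorem exists_sequences (hsimple : IsSimpleCStarAlgebra A) (hrr0 : RealRankZero A)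
    (hsc : StrictComparison A)
    {a b : A} (ha : 0 ≤ a) (hb : 0 ≤ b) (hab : CuntzEquiv a b)
    (hne : ∀ G, IsStarProjection G → Dom G a → (1 - G) * a * (1 - G) ≠ 0)
    (hne' : ∀ G, IsStarProjection G → Dom G b → (1 - G) * b * (1 - G) ≠ 0) :
    ∃ p q E F : ℕ → A, (∀ n, IsStarProjection (p n)) ∧ (∀ n, IsStarProjection (q n)) ∧
      (∀ n, IsStarProjection (E n)) ∧ (∀ n, IsStarProjection (F n)) ∧
      E 0 = 0 ∧ F 0 = 0 ∧ (∀ n, E (n + 1) = E n + p n) ∧ (∀ n, F (n + 1) = F n + q n) ∧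
      (∀ n, E n * p n = 0) ∧ (∀ n, F n * q n = 0) ∧ (∀ n, Eqv (p n) (q n)) ∧
      (∀ n, Dom (E n) a) ∧ (∀ n, Dom (F n) b) ∧
      (∀ n, (1 - E (n + 1)) * a * (1 - E (n + 1)) ≤ ((1 / 2 : ℝ) ^ n) • (1 : A)) ∧
      (∀ n, (1 - F (n + 1)) * b * (1 - F (n + 1)) ≤ ((1 / 2 : ℝ) ^ n) • (1 : A)) := by
  let X := {x : A × A // IsStarProjection x.1 ∧ IsStarProjection x.2 ∧
    (∀ φ : A →ₗ[ℂ] ℂ, IsTracialState φ → tr φ x.1 = tr φ x.2) ∧ Dom x.1 a ∧ Dom x.2 b}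
  have hstep : ∀ (n : ℕ) (x : X), ∃ pq : A × A, IsStarProjection pq.1 ∧ IsStarProjection pq.2 ∧
      Eqv pq.1 pq.2 ∧ x.1.1 * pq.1 = 0 ∧ x.1.2 * pq.2 = 0 ∧ Dom pq.1 a ∧ Dom pq.2 b ∧
      (1 - (x.1.1 + pq.1)) * a * (1 - (x.1.1 + pq.1)) ≤ ((1 / 2 : ℝ) ^ n) • (1 : A) ∧
      (1 - (x.1.2 + pq.2)) * b * (1 - (x.1.2 + pq.2)) ≤ ((1 / 2 : ℝ) ^ n) • (1 : A) := by
    rintro n ⟨⟨E, F⟩, hE, hF, htr, hEa, hFb⟩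
    obtain ⟨p, q, h⟩ := bistep hsimple hrr0 hsc ha hb hab hE hF htr hEa hFb hne hne'
      (show (0 : ℝ) < (1 / 2 : ℝ) ^ n by positivity)
    exact ⟨(p, q), h⟩
  choose pq hp hq heqv hEp hFq hpa hqb hs1 hs2 using hstep
  let nxt : ℕ → X → X := fun n x => ⟨(x.1.1 + (pq n x).1, x.1.2 + (pq n x).2),
    proj_add x.2.1 (hp n x) (hEp n x), proj_add x.2.2.1 (hq n x) (hFq n x),
    fun φ hφ => by
      show tr φ (x.1.1 + (pq n x).1) = tr φ (x.1.2 + (pq n x).2)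
      rw [tr_add, tr_add, x.2.2.2.1 φ hφ, (heqv n x).tr_eq hφ],
    x.2.2.2.2.1.add (hpa n x), x.2.2.2.2.2.add (hqb n x)⟩
  have hz : ∀ y : A, 0 ≤ y → Dom (0 : A) y := fun y hy => Dom.of_le hy
  let x0 : X := ⟨(0, 0), IsStarProjection.zero A, IsStarProjection.zero A, fun _ _ => rfl,
    hz a ha, hz b hb⟩
  let s : ℕ → X := fun n => Nat.rec x0 nxt n
  exact ⟨fun n => (pq n (s n)).1, fun n => (pq n (s n)).2, fun n => (s n).1.1, fun n => (s n).1.2,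
    fun n => hp n _, fun n => hq n _, fun n => (s n).2.1, fun n => (s n).2.2.1, rfl, rfl,
    fun n => rfl, fun n => rfl, fun n => hEp n _, fun n => hFq n _, fun n => heqv n _,
    fun n => (s n).2.2.2.2.1, fun n => (s n).2.2.2.2.2, fun n => hs1 n _, fun n => hs2 n _⟩

end Steps


section Paths
set_option linter.unusedSectionVars false

theorem joined_seq {X : Type*} [NormedAddCommGroup X] {S : Set X} {b : X}
    {c : ℕ → X} {ε : ℕ → ℝ}
    (h : ∀ n, JoinedIn (S ∩ Metric.closedBall b (ε n)) (c n) (c (n + 1)))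
    (hε : Tendsto ε atTop (𝓝 0)) (hb : b ∈ S) : JoinedIn S (c 0) b := by
  let γ : ∀ n, Path (c n) (c (n + 1)) := fun n => (h n).somePath
  have hγ : ∀ n s, (γ n).extend s ∈ S ∩ Metric.closedBall b (ε n) := by
    intro n s
    have : (γ n).extend s ∈ Set.range (γ n) := by
      rw [← (γ n).extend_range]; exact ⟨s, rfl⟩
    obtain ⟨y, hy⟩ := this
    rw [← hy]; exact (h n).somePath_mem y
  let H : ℕ → ℝ → X := fun N x => c 0 + ∑ n ∈ Finset.range N, ((γ n).extend (x - n) - c n)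
  have hHc : ∀ N, Continuous (H N) := by
    intro N
    have : ∀ n, Continuous fun x : ℝ => (γ n).extend (x - n) := fun n =>
      (γ n).continuous_extend.comp (by fun_prop)
    exact continuous_const.add (continuous_finsetSum _ fun n _ => (this n).sub continuous_const)
  have hHe : ∀ (N M : ℕ) (x : ℝ), x ≤ N → N ≤ M → H N x = H M x := by
    intro N M x hx hNM
    show c 0 + _ = c 0 + _
    congr 1
    refine Finset.sum_subset (Finset.range_subset_range.2 hNM) fun n _ hn => ?_
    have hn : N ≤ n := by simpa using hn
    have : (N : ℝ) ≤ n := by exact_mod_cast hn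
    rw [Path.extend_of_le_zero _ (by linarith), sub_self]
  let G : ℝ → X := fun x => H ⌈x⌉₊ x
  have hG : ∀ (N : ℕ) (x : ℝ), x ≤ N → G x = H N x := fun N x hx =>
    hHe _ _ x (Nat.le_ceil x) (Nat.ceil_le.2 hx)
  have hGm : ∀ x : ℝ, 0 ≤ x → G x ∈ S ∩ Metric.closedBall b (ε ⌊x⌋₊) := by
    intro x hx
    have h1 := Nat.floor_le hx
    have h2 := (Nat.lt_floor_add_one x).le
    rw [hG (⌊x⌋₊ + 1) x (by push_cast; exact h2)]
    have : H (⌊x⌋₊ + 1) x = (γ ⌊x⌋₊).extend (x - ⌊x⌋₊) := by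
      show c 0 + _ = _
      rw [Finset.sum_range_succ]
      have : ∑ n ∈ Finset.range ⌊x⌋₊, ((γ n).extend (x - n) - c n)
          = ∑ n ∈ Finset.range ⌊x⌋₊, (c (n + 1) - c n) := by
        refine Finset.sum_congr rfl fun n hn => ?_
        have hn : n + 1 ≤ ⌊x⌋₊ := by simpa using hn
        have hn : (n : ℝ) + 1 ≤ ⌊x⌋₊ := by exact_mod_cast hn
        rw [Path.extend_of_one_le _ (by linarith)]
      rw [this, Finset.sum_range_sub]; abel
    rw [this]; exact hγ _ _
  let f : ℝ → X := fun t => if t < 1 then G (t / (1 - t)) else b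
  refine JoinedIn.ofLine (f := f) ?_ ?_ ?_ ?_
  · intro t ht
    rcases lt_or_eq_of_le ht.2 with h1 | h1
    · apply ContinuousAt.continuousWithinAt
      obtain ⟨N, hN⟩ := exists_nat_gt (t / (1 - t))
      have hc : ContinuousAt (fun s : ℝ => s / (1 - s)) t :=
        continuousAt_id.div (by fun_prop) (by linarith)
      have e1 : ∀ᶠ s : ℝ in 𝓝 t, s / (1 - s) < (N : ℝ) := hc.eventually (gt_mem_nhds hN)
      have e2 : ∀ᶠ s : ℝ in 𝓝 t, s < 1 := gt_mem_nhds h1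
      have : f =ᶠ[𝓝 t] fun s => H N (s / (1 - s)) := by
        filter_upwards [e1, e2] with s hs1 hs2
        show (if s < 1 then G (s / (1 - s)) else b) = _
        rw [if_pos hs2, hG N _ hs1.le]
      exact ContinuousAt.congr ((hHc N).continuousAt.comp hc) this.symm
    · subst h1
      have hf1 : f 1 = b := if_neg (lt_irrefl _)
      rw [ContinuousWithinAt, hf1, Metric.tendsto_nhds]
      intro δ hδ
      obtain ⟨N, hN⟩ := eventually_atTop.1 (hε.eventually (gt_mem_nhds hδ))
      have : ∀ᶠ s : ℝ in 𝓝[unitInterval] 1, (N : ℝ) / (N + 1) < s :=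
        eventually_nhdsWithin_of_eventually_nhds (lt_mem_nhds (by
          rw [div_lt_one (by positivity)]; linarith))
      filter_upwards [this, self_mem_nhdsWithin] with s hs hsI
      by_cases hs1 : s < 1
      · show dist (if s < 1 then G (s / (1 - s)) else b) b < δ
        rw [if_pos hs1]
        have hpos : 0 < 1 - s := by linarith
        have hge : (N : ℝ) ≤ s / (1 - s) := by
          rw [le_div_iff₀ hpos]
          rw [div_lt_iff₀ (by positivity)] at hs
          nlinarith
        have := (hGm (s / (1 - s)) (div_nonneg hsI.1 hpos.le)).2
        exact lt_of_le_of_lt this (hN _ (Nat.le_floor hge))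
      · show dist (if s < 1 then G (s / (1 - s)) else b) b < δ
        rw [if_neg hs1, dist_self]; exact hδ
  · show (if (0 : ℝ) < 1 then G (0 / (1 - 0)) else b) = _
    rw [if_pos one_pos, hG 0 _ (by simp)]
    simp [H]
  · exact if_neg (lt_irrefl _)
  · rintro _ ⟨t, ht, rfl⟩
    show (if t < 1 then G (t / (1 - t)) else b) ∈ S
    split_ifs with h1
    · exact (hGm _ (div_nonneg ht.1 (by linarith))).1
    · exact hb

variable {A : Type*} [CStarAlgebra A] [PartialOrder A] [StarOrderedRing A]

lemma joined_of_dom {a b q : A} (hb : 0 ≤ b) (hq : 0 ≤ q) (h1 : Dom b q) (h2 : Dom q b)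
    (hqa : CuntzEquiv q a) : JoinedIn {b : A | 0 ≤ b ∧ CuntzEquiv b a} b q := by
  apply JoinedIn.of_segment_subset
  rintro _ ⟨s, t, hs, ht, hst, rfl⟩
  have hx : 0 ≤ s • b + t • q := add_nonneg (smul_nonneg hs hb) (smul_nonneg ht hq)
  have d1 : Dom (s • b + t • q) q := (Dom.smul hq h1 hs).add (Dom.smul hq (Dom.refl q) ht)
  have d2 : Dom q (s • b + t • q) := by
    rcases lt_or_ge 0 t with h | h
    · refine ⟨t⁻¹, inv_pos.2 h, ?_⟩
      rw [smul_add, smul_smul t⁻¹ t, inv_mul_cancel₀ h.ne', one_smul]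
      exact le_add_of_nonneg_left (smul_nonneg (inv_nonneg.2 ht) (smul_nonneg hs hb))
    · have h0 : t = 0 := le_antisymm h ht
      have hs1 : s = 1 := by linarith
      simpa [h0, hs1] using h2
  exact ⟨hx, CuntzEquiv.trans' ⟨CuntzLE.of_dom hx d1, CuntzLE.of_dom hq d2⟩ hqa⟩

lemma joined_conj {r u c : A} {T : Set A} (hu : JoinedIn (UR r) 1 u)
    (h : ∀ v ∈ UR r, v * c * star v ∈ T) : JoinedIn T c (u * c * star u) := by
  have := (hu.map (f := fun v => v * c * star v) (by fun_prop)).mono (V := T) (by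
    rintro _ ⟨v, hv, rfl⟩; exact h v hv)
  simpa using this

lemma corner_eq {b q : A} (hb : 0 ≤ b) (hq : IsStarProjection q)
    (h : (1 - q) * b * (1 - q) = 0) : q * b * q = b := by
  have hs : star (1 - q) = 1 - q := hq.one_sub.isSelfAdjoint.star_eq
  have h1 : b * (1 - q) = 0 := eq_zero_of_star_conj hb (by rw [hs]; exact h)
  have h2 : (1 - q) * b = 0 := by
    have := congrArg star h1
    rwa [star_mul, hs, hb.star_eq, star_zero] at this
  rw [mul_sub, mul_one, sub_eq_zero] at h1
  rw [sub_mul, one_mul, sub_eq_zero] at h2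
  rw [← h2, ← h1]

lemma Eqv.cuntz {p q : A} (hp : IsStarProjection p) (hq : IsStarProjection q) (h : Eqv p q) :
    CuntzEquiv p q := by
  obtain ⟨w, h1, h2⟩ := h
  refine ⟨CuntzLE.of_eq_conj (v := w) ?_, CuntzLE.of_eq_conj (v := star w) ?_⟩
  · rw [← h2, ← mul_assoc, mul_assoc, h1, hp.isIdempotentElem.eq]
  · rw [← h1, star_star, ← mul_assoc, mul_assoc, h2, hq.isIdempotentElem.eq]

theorem caseA (hsimple : IsSimpleCStarAlgebra A) (hdiv : ApproximatelyDivisible A)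
    (hrr0 : RealRankZero A) (hsc : StrictComparison A) {a p b : A} (hp : IsStarProjection p)
    (hpa : CuntzEquiv p a) (hb : 0 ≤ b) (hba : CuntzEquiv b a) :
    JoinedIn {b : A | 0 ≤ b ∧ CuntzEquiv b a} p b := by
  have hbp : CuntzEquiv b p := hba.trans' hpa.symm'
  obtain ⟨w, hw, hq, hqb⟩ := sub_of_cuntz hp hb (Dom.refl p) hbp.2
  have hpq : Eqv p (star w * w) := ⟨w, hw, rfl⟩
  generalize star w * w = q at hq hqb hpq
  have h0 : (1 - q) * b * (1 - q) = 0 := by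
    by_contra hne
    obtain ⟨e, he, hqe, heb, he0⟩ := corner_nonzero hrr0 hb hq hqb hne
    obtain ⟨x, hx, hx2, hx3⟩ := sub_of_cuntz (proj_add hq he hqe) hp.nonneg (hqb.add heb) hbp.1
    have hE : Eqv (q + e) (star x * x) := ⟨x, hx, rfl⟩
    have : Nontrivial A := ⟨e, 0, he0⟩
    obtain ⟨φ, hφ⟩ := exists_trace hsc
    obtain ⟨δ, hδ, hl⟩ := tr_lower hsimple he he0
    have h1 := tr_mono hφ (hx3.proj hx2 hp).2.2
    rw [← hE.tr_eq hφ, tr_add, hpq.tr_eq hφ] at h1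
    linarith [hl φ hφ]
  have hbq : Dom b q := by
    rw [← corner_eq hb hq h0]; exact dom_conj hb hq
  have hqa : CuntzEquiv q a := (hpq.cuntz hp hq).symm'.trans' hpa
  have j1 := joined_of_dom hb hq.nonneg hbq hqb hqa
  obtain ⟨u, hu, rfl⟩ := multi hsimple hdiv hrr0 hsc (IsStarProjection.one A) hp hq
    ⟨mul_one _, one_mul _⟩ ⟨mul_one _, one_mul _⟩ hpq
  refine (joined_conj (T := {b : A | 0 ≤ b ∧ CuntzEquiv b a}) hu fun v hv => ⟨(proj_conj hp hv.1).nonneg, ?_⟩).trans j1.symm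
  exact (CuntzEquiv.unitary hv.1).trans' hpa

end Paths


section Final
set_option linter.unusedSectionVars false
variable {A : Type*} [CStarAlgebra A] [PartialOrder A] [StarOrderedRing A]

/-- weighted partial sums -/
noncomputable def psum (p : ℕ → A) (N : ℕ) : A := ∑ i ∈ Finset.range N, ((1 / 2 : ℝ) ^ i) • p i

/-- weighted full sum -/
noncomputable def fsum (p : ℕ → A) : A := ∑' i, ((1 / 2 : ℝ) ^ i) • p i

lemma psum_succ (p : ℕ → A) (N : ℕ) : psum p (N + 1) = psum p N + ((1 / 2 : ℝ) ^ N) • p N :=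
  Finset.sum_range_succ _ _

lemma term_nonneg {p : ℕ → A} (hp : ∀ n, IsStarProjection (p n)) (n : ℕ) :
    0 ≤ ((1 / 2 : ℝ) ^ n) • p n := smul_nonneg (by positivity) (hp n).nonneg

lemma psum_nonneg {p : ℕ → A} (hp : ∀ n, IsStarProjection (p n)) (N : ℕ) : 0 ≤ psum p N :=
  Finset.sum_nonneg fun i _ => term_nonneg hp i

lemma term_norm {p : ℕ → A} (hp : ∀ n, IsStarProjection (p n)) (n : ℕ) :
    ‖((1 / 2 : ℝ) ^ n) • p n‖ ≤ (1 / 2 : ℝ) ^ n := by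
  rw [norm_smul, Real.norm_of_nonneg (by positivity)]
  exact mul_le_of_le_one_right (by positivity) ((hp n).norm_le _)

lemma term_summable {p : ℕ → A} (hp : ∀ n, IsStarProjection (p n)) :
    Summable fun n => ((1 / 2 : ℝ) ^ n) • p n :=
  Summable.of_norm_bounded summable_geometric_two (term_norm hp)

lemma psum_le {p : ℕ → A} (hp : ∀ n, IsStarProjection (p n)) (N : ℕ) : psum p N ≤ fsum p :=
  (term_summable hp).sum_le_tsum _ fun i _ => term_nonneg hp i

lemma fsum_nonneg {p : ℕ → A} (hp : ∀ n, IsStarProjection (p n)) : 0 ≤ fsum p :=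
  tsum_nonneg (term_nonneg hp)

lemma fsum_sub_norm {p : ℕ → A} (hp : ∀ n, IsStarProjection (p n)) (N : ℕ) :
    ‖fsum p - psum p N‖ ≤ 2 * (1 / 2 : ℝ) ^ N := by
  have h1 := (term_summable hp).sum_add_tsum_nat_add N
  have h2 : fsum p - psum p N = ∑' i, ((1 / 2 : ℝ) ^ (i + N)) • p (i + N) := by
    rw [sub_eq_iff_eq_add, fsum, psum, ← h1, add_comm]
  rw [h2]
  refine tsum_of_norm_bounded (g := fun i => (1 / 2 : ℝ) ^ (i + N)) ?_ fun i => term_norm hp _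
  have := hasSum_geometric_two.mul_right ((1 / 2 : ℝ) ^ N)
  simpa only [pow_add] using this

lemma dom_E_psum {p E : ℕ → A} (hp : ∀ n, IsStarProjection (p n))
    (hE0 : E 0 = 0) (hEs : ∀ n, E (n + 1) = E n + p n) (N : ℕ) : Dom (E N) (psum p N) := by
  induction N with
  | zero => rw [hE0]; simpa [psum] using Dom.refl (0 : A)
  | succ n ih =>
    rw [hEs, psum_succ]
    refine (ih.trans (Dom.of_le (le_add_of_nonneg_right (term_nonneg hp n)))).add ?_
    refine Dom.trans (y := ((1 / 2 : ℝ) ^ n) • p n) ⟨2 ^ n, by positivity, ?_⟩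
      (Dom.of_le (le_add_of_nonneg_left (psum_nonneg hp n)))
    rw [smul_smul, ← mul_pow]; norm_num

lemma dom_psum_E {p E : ℕ → A} (hp : ∀ n, IsStarProjection (p n))
    (hE : ∀ n, IsStarProjection (E n)) (hE0 : E 0 = 0) (hEs : ∀ n, E (n + 1) = E n + p n) (N : ℕ) : Dom (psum p N) (E N) := by
  induction N with
  | zero => rw [hE0]; simpa [psum] using Dom.refl (0 : A)
  | succ n ih =>
    have h1 : E n ≤ E (n + 1) := by rw [hEs]; exact le_add_of_nonneg_right (hp n).nonneg
    have h2 : p n ≤ E (n + 1) := by rw [hEs]; exact le_add_of_nonneg_left (hE n).nonneg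
    rw [psum_succ]
    exact (ih.trans (Dom.of_le h1)).add
      (Dom.smul (hE _).nonneg (Dom.of_le h2) (by positivity))

lemma corner_close {a E : A} (ha : 0 ≤ a) (hE : IsStarProjection E) {η : ℝ} (hη : 0 ≤ η)
    (h : (1 - E) * a * (1 - E) ≤ (η ^ 2) • (1 : A)) :
    ‖E * a * E - a‖ ≤ 2 * ‖CFC.sqrt a‖ * η := by
  have hs := CFC.sqrt_mul_sqrt_self a ha
  have hsa : star (CFC.sqrt a) = CFC.sqrt a := (CFC.sqrt_nonneg a).star_eq
  generalize CFC.sqrt a = s at hs hsa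
  have hP : star (1 - E) = 1 - E := hE.one_sub.isSelfAdjoint.star_eq
  have hy2 : star (s * (1 - E)) * (s * (1 - E)) = (1 - E) * a * (1 - E) := by
    rw [star_mul, hsa, hP, ← hs]; simp only [mul_assoc]
  have hy : ‖s * (1 - E)‖ ≤ η := by
    have h1 := norm_le_of_le_smul_one (by positivity) (conj_nonneg ha hE.one_sub) h
    rw [← hy2, CStarRing.norm_star_mul_self, ← sq] at h1
    exact (sq_le_sq₀ (norm_nonneg _) hη).1 h1
  have hid : E * a * E - a = -(s * (s * (1 - E)) + star (s * (1 - E)) * (s * E)) := by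
    rw [star_mul, hsa, hP, ← hs]; noncomm_ring
  rw [hid, norm_neg]
  have hn : ‖s * E‖ ≤ ‖s‖ := (norm_mul_le _ _).trans
    (mul_le_of_le_one_right (norm_nonneg _) (hE.norm_le _))
  calc _ ≤ ‖s‖ * ‖s * (1 - E)‖ + ‖s * (1 - E)‖ * ‖s * E‖ := by
        refine (norm_add_le _ _).trans (add_le_add (norm_mul_le _ _) ?_)
        refine (norm_mul_le _ _).trans ?_
        rw [norm_star]
    _ ≤ ‖s‖ * η + η * ‖s‖ := by gcongr
    _ = _ := by ring

theorem joined_fsum {a c : A} {p E : ℕ → A} (hp : ∀ n, IsStarProjection (p n))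
    (hE : ∀ n, IsStarProjection (E n))
    (hE0 : E 0 = 0) (hEs : ∀ n, E (n + 1) = E n + p n) (ha : 0 ≤ a) (hac : CuntzEquiv a c)
    (hEa : ∀ n, Dom (E n) a)
    (hres : ∀ n, (1 - E (n + 1)) * a * (1 - E (n + 1)) ≤ ((1 / 2 : ℝ) ^ n) • (1 : A)) :
    JoinedIn {b : A | 0 ≤ b ∧ CuntzEquiv b c} a (fsum p) := by
  apply JoinedIn.of_segment_subset
  rintro _ ⟨s, t, hs, ht, hst, rfl⟩
  have hx : 0 ≤ s • a + t • fsum p :=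
    add_nonneg (smul_nonneg hs ha) (smul_nonneg ht (fsum_nonneg hp))
  refine ⟨hx, CuntzEquiv.trans' ⟨?_, ?_⟩ hac⟩
  · refine CuntzLE.of_approx fun ε hε => ?_
    obtain ⟨N, hN⟩ := exists_pow_lt_of_lt_one (show 0 < ε / 2 by positivity)
      (show (1 / 2 : ℝ) < 1 by norm_num)
    refine ⟨s • a + t • psum p N, CuntzLE.of_dom ?_ ?_, ?_⟩
    · exact add_nonneg (smul_nonneg hs ha) (smul_nonneg ht (psum_nonneg hp N))
    · exact (Dom.smul ha (Dom.refl a) hs).add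
        (Dom.smul ha ((dom_psum_E hp hE hE0 hEs N).trans (hEa N)) ht)
    · have : s • a + t • psum p N - (s • a + t • fsum p) = -(t • (fsum p - psum p N)) := by
        rw [smul_sub]; abel
      rw [this, norm_neg, norm_smul, Real.norm_of_nonneg ht]
      have h1 := fsum_sub_norm hp N
      have h2 : t * ‖fsum p - psum p N‖ ≤ ‖fsum p - psum p N‖ :=
        mul_le_of_le_one_left (norm_nonneg _) (by linarith)
      linarith
  · rcases lt_or_ge 0 s with h | h
    · refine CuntzLE.of_dom ha ⟨s⁻¹, inv_pos.2 h, ?_⟩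
      rw [smul_add, smul_smul s⁻¹ s, inv_mul_cancel₀ h.ne', one_smul]
      exact le_add_of_nonneg_right (smul_nonneg (inv_nonneg.2 hs)
        (smul_nonneg ht (fsum_nonneg hp)))
    · have h0 : s = 0 := le_antisymm h hs
      have ht1 : t = 1 := by linarith
      rw [h0, ht1, zero_smul, one_smul, zero_add]
      refine CuntzLE.of_approx fun ε hε => ?_
      have hK : 0 < 2 * ‖CFC.sqrt a‖ + 1 := by positivity
      obtain ⟨N, hN⟩ := exists_pow_lt_of_lt_one
        (show 0 < (ε / (2 * ‖CFC.sqrt a‖ + 1)) ^ 2 by positivity)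
        (show (1 / 2 : ℝ) < 1 by norm_num)
      refine ⟨E (N + 1) * a * E (N + 1), CuntzLE.of_dom (conj_nonneg ha (hE _)) ?_, ?_⟩
      · exact (dom_conj ha (hE _)).trans ((dom_E_psum hp hE0 hEs _).trans
          (Dom.of_le (psum_le hp _)))
      · have h1 := corner_close ha (hE (N + 1)) (η := ε / (2 * ‖CFC.sqrt a‖ + 1)) (by positivity)
          ((hres N).trans (smul_le_smul_of_nonneg_right hN.le zero_le_one))
        refine h1.trans_lt ?_
        rw [mul_div_assoc', div_lt_iff₀ hK]
        nlinarith

lemma norm_isom {u : A} (h : star u * u = 1) : ‖u‖ ≤ 1 := by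
  have h1 : ‖u‖ * ‖u‖ ≤ 1 := by
    rw [← CStarRing.norm_star_mul_self, h]; exact (IsStarProjection.one A).norm_le _
  nlinarith [norm_nonneg u]

lemma norm_conj_le {u x : A} (h : star u * u = 1) : ‖u * x * star u‖ ≤ ‖x‖ := by
  have h1 := norm_isom h
  calc _ ≤ ‖u‖ * ‖x‖ * ‖u‖ := by
        refine (norm_mul_le _ _).trans ?_
        rw [norm_star]; gcongr; exact norm_mul_le _ _
    _ ≤ 1 * ‖x‖ * 1 := by gcongr
    _ = _ := by ring

lemma UR.fix {v F t : A} (hv : v ∈ UR (1 - F)) (hF : IsStarProjection F) (ht : 0 ≤ t)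
    (hd : Dom t F) : v * t * star v = t := by
  obtain ⟨-, -, h3, -⟩ := hv
  rw [sub_sub_cancel] at h3
  have h1 : t * (1 - F) = 0 := hd.kill ht hF.mul_one_sub_self
  rw [mul_sub, mul_one, sub_eq_zero] at h1
  have h2 : F * t = t := by
    have := congrArg star h1
    rw [star_mul, ht.star_eq, hF.isSelfAdjoint.star_eq] at this
    exact this.symm
  have h4 : v * t = t := by rw [← h2, ← mul_assoc, h3]
  have h5 : t * star v = t := by
    have := congrArg star h4
    rwa [star_mul, ht.star_eq] at this
  rw [h4, h5]

lemma joined_fsum_fsum (hsimple : IsSimpleCStarAlgebra A) (hdiv : ApproximatelyDivisible A)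
    (hrr0 : RealRankZero A) (hsc : StrictComparison A) {c : A} {p q E F : ℕ → A}
    (hp : ∀ n, IsStarProjection (p n)) (hq : ∀ n, IsStarProjection (q n))
    (hE : ∀ n, IsStarProjection (E n)) (hF : ∀ n, IsStarProjection (F n))
    (hE0 : E 0 = 0) (hF0 : F 0 = 0)
    (hEs : ∀ n, E (n + 1) = E n + p n) (hFs : ∀ n, F (n + 1) = F n + q n)
    (hEp : ∀ n, E n * p n = 0) (hFq : ∀ n, F n * q n = 0) (hpq : ∀ n, Eqv (p n) (q n))
    (hpc : CuntzEquiv (fsum p) c) (hqc : CuntzEquiv (fsum q) c) :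
    JoinedIn {b : A | 0 ≤ b ∧ CuntzEquiv b c} (fsum p) (fsum q) := by
  let Y : ℕ → Type _ := fun n => {U : A // star U * U = 1 ∧ U * E n * star U = F n ∧
    U * psum p n * star U = psum q n}
  have hstep : ∀ n (U : Y n), ∃ u : A, JoinedIn (UR (1 - F n)) 1 u ∧ star (u * U.1) * (u * U.1) = 1 ∧
      (u * U.1) * E (n + 1) * star (u * U.1) = F (n + 1) ∧
      (u * U.1) * psum p (n + 1) * star (u * U.1) = psum q (n + 1) := by
    rintro n ⟨U, hU, hUE, hUs⟩
    have hUp := proj_conj (hp n) hU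
    have h0 : (U * p n * star U) * F n = 0 := by
      apply orth_symm (hF n) hUp
      rw [← hUE]
      calc _ = U * E n * (star U * U) * p n * star U := by simp only [mul_assoc]
        _ = U * (E n * p n) * star U := by rw [hU, mul_one]; simp only [mul_assoc]
        _ = 0 := by rw [hEp, mul_zero, zero_mul]
    obtain ⟨u, hu, huq⟩ := multi hsimple hdiv hrr0 hsc (hF n).one_sub hUp (hq n)
      (PLe.sub_right hUp (hF n) ⟨mul_one _, one_mul _⟩ h0)
      (PLe.sub_right (hq n) (hF n) ⟨mul_one _, one_mul _⟩ (orth_symm (hF n) (hq n) (hFq n)))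
      ((Eqv.unitary (hp n) hU).symm.trans hUp (hq n) (hpq n))
    have hum := hu.target_mem
    have e1 := UR.fix hum (hF n) (hF n).nonneg (Dom.refl _)
    have e2 := UR.fix hum (hF n) (psum_nonneg hq n) (dom_psum_E hq hF hF0 hFs n)
    have hc : ∀ x, u * U * x * star (u * U) = u * (U * x * star U) * star u := by
      intro x; rw [star_mul]; simp only [mul_assoc]
    refine ⟨u, hu, ?_, ?_, ?_⟩
    · show star (u * U) * (u * U) = 1
      rw [star_mul, mul_assoc, mul_mid hum.1, one_mul, hU]
    · show u * U * _ * star (u * U) = _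
      rw [hc, hEs, hFs, mul_add, add_mul, mul_add, add_mul, hUE, huq, e1]
    · show u * U * _ * star (u * U) = _
      rw [hc, psum_succ, psum_succ, mul_add, add_mul, mul_add, add_mul, hUs, e2, mul_smul_comm,
        smul_mul_assoc, mul_smul_comm, smul_mul_assoc, huq]
  choose u hu h1 h2 h3 using hstep
  let s : ∀ n, Y n := fun n => Nat.rec (motive := Y)
    ⟨1, by simp, by simp [hE0, hF0], by simp [psum]⟩
    (fun n U => ⟨u n U * U.1, h1 n U, h2 n U, h3 n U⟩) n
  have hs0 : (s 0).1 = 1 := rfl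
  have hss : ∀ n, (s (n + 1)).1 = u n (s n) * (s n).1 := fun n => rfl
  have key := joined_seq (S := {b : A | 0 ≤ b ∧ CuntzEquiv b c}) (b := fsum q)
    (c := fun n => (s n).1 * fsum p * star (s n).1) (ε := fun n => 4 * (1 / 2 : ℝ) ^ n) ?_ ?_
    ⟨fsum_nonneg hq, hqc⟩
  · simpa [hs0] using key
  · intro n
    have hj := joined_conj (c := (s n).1 * fsum p * star (s n).1)
      (T := {b : A | 0 ≤ b ∧ CuntzEquiv b c} ∩ Metric.closedBall (fsum q) (4 * (1 / 2 : ℝ) ^ n))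
      (hu n (s n)) ?_
    · have : (s (n + 1)).1 * fsum p * star (s (n + 1)).1 =
          u n (s n) * ((s n).1 * fsum p * star (s n).1) * star (u n (s n)) := by
        rw [hss, star_mul]; simp only [mul_assoc]
      show JoinedIn _ _ ((s (n + 1)).1 * fsum p * star (s (n + 1)).1)
      rw [this]; exact hj
    · intro v hv
      obtain ⟨hU, hUE, hUs⟩ := (s n).2
      generalize (s n).1 = U at hU hUE hUs
      have hvU : star (v * U) * (v * U) = 1 := by
        rw [star_mul, mul_assoc, mul_mid hv.1, one_mul, hU]
      have hc : ∀ x, v * (U * x * star U) * star v = v * U * x * star (v * U) := by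
        intro x; rw [star_mul]; simp only [mul_assoc]
      have e2 := UR.fix hv (hF n) (psum_nonneg hq n) (dom_psum_E hq hF hF0 hFs n)
      refine ⟨⟨?_, ?_⟩, ?_⟩
      · rw [hc]; exact star_right_conjugate_nonneg (fsum_nonneg hp) _
      · rw [hc]; exact (CuntzEquiv.unitary hvU).trans' hpc
      · rw [Metric.mem_closedBall, dist_eq_norm]
        have : v * (U * fsum p * star U) * star v - fsum q
            = v * U * (fsum p - psum p n) * star (v * U) - (fsum q - psum q n) := by
          rw [mul_sub, sub_mul, ← hc, ← hc (psum p n), hUs, e2]; abel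
        rw [this]
        have b1 := fsum_sub_norm hp n
        have b2 := fsum_sub_norm hq n
        have b3 := norm_conj_le (x := fsum p - psum p n) hvU
        have b4 := norm_sub_le (v * U * (fsum p - psum p n) * star (v * U)) (fsum q - psum q n)
        linarith
  · have := (tendsto_pow_atTop_nhds_zero_of_lt_one (show (0 : ℝ) ≤ 1 / 2 by norm_num)
      (by norm_num)).const_mul 4
    simpa only [mul_zero] using this

theorem caseB (hsimple : IsSimpleCStarAlgebra A) (hdiv : ApproximatelyDivisible A)
    (hrr0 : RealRankZero A) (hsc : StrictComparison A) {a b : A} (ha : 0 ≤ a)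
    (hno : ∀ p, IsStarProjection p → ¬ CuntzEquiv p a) (hb : 0 ≤ b) (hba : CuntzEquiv b a) :
    JoinedIn {b : A | 0 ≤ b ∧ CuntzEquiv b a} a b := by
  have hne : ∀ x, 0 ≤ x → CuntzEquiv x a →
      ∀ G, IsStarProjection G → Dom G x → (1 - G) * x * (1 - G) ≠ 0 := by
    intro x hx hxa G hG hd h0
    refine hno G hG (CuntzEquiv.trans' ⟨CuntzLE.of_dom hG.nonneg hd, CuntzLE.of_dom hx ?_⟩ hxa)
    rw [← corner_eq hx hG h0]; exact dom_conj hx hG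
  have haa : CuntzEquiv a a := ⟨CuntzLE.refl' a, CuntzLE.refl' a⟩
  obtain ⟨p, q, E, F, hp, hq, hE, hF, hE0, hF0, hEs, hFs, hEp, hFq, hpq, hEa, hFb, hr1, hr2⟩ :=
    exists_sequences hsimple hrr0 hsc ha hb hba.symm' (hne a ha haa) (hne b hb hba)
  have j1 := joined_fsum hp hE hE0 hEs ha haa hEa hr1
  have j2 := joined_fsum hq hF hF0 hFs hb hba hFb hr2
  exact (j1.trans (joined_fsum_fsum hsimple hdiv hrr0 hsc hp hq hE hF hE0 hF0 hEs hFs hEp hFq hpq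
    j1.target_mem.2 j2.target_mem.2)).trans j2.symm

end Final

/-- If `A` is a unital simple separable C*-algebra which is approximately
divisible, of real rank zero, stably finite, and has strict comparison of positive elements,
then for every positive `a ∈ A` the set of positive elements Cuntz equivalent to `a` is
path connected in the norm topology. -/
theorem cuntz_class_pathConnected {A : Type*} [CStarAlgebra A] [PartialOrder A]
    [StarOrderedRing A] [TopologicalSpace.SeparableSpace A]
    (hsimple : IsSimpleCStarAlgebra A)
    (hdiv : ApproximatelyDivisible A)
    (hrr0 : RealRankZero A)
    (hsf : StablyFinite A)
    (hsc : StrictComparison A)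
    (a : A) (ha : 0 ≤ a) :
    IsPathConnected {b : A | 0 ≤ b ∧ CuntzEquiv b a} := by
  by_cases h : ∃ p : A, IsStarProjection p ∧ CuntzEquiv p a
  · obtain ⟨p, hp, hpa⟩ := h
    exact ⟨p, ⟨hp.nonneg, hpa⟩, fun _ hb => caseA hsimple hdiv hrr0 hsc hp hpa hb.1 hb.2⟩
  · push Not at h
    exact ⟨a, ⟨ha, CuntzLE.refl' a, CuntzLE.refl' a⟩,
      fun _ hb => caseB hsimple hdiv hrr0 hsc ha h hb.1 hb.2⟩
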